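/- arXiv:1804.01569 — 4 statements merged into one kernel-verified Lean document; each statement's English description precedes it below -/
import Mathlib

section
/- Let p > 2 be a prime and let C be a smooth plane curve of degree d over F_p with d ≤ p + 1. Then there exists an F_p-line L such that L intersects C transversely, i.e., L ∩ C consists of d distinct points over the algebraic closure of F_p. -/
open MvPolynomial

noncomputable section

/-- The projective plane over a field `K`, as the projectivization of `K^3`. -/
abbrev ProjPlane (K : Type*) [Field K] := Projectivization K (Fin 3 → K)

variable {F : Type*} [Field F]

/-- A geometric point (over the algebraic closure) lies on the plane curve defined by `f`. -/
def OnCurve (f : MvPolynomial (Fin 3) F) (P : ProjPlane (AlgebraicClosure F)) : Prop :=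
  aeval P.rep f = 0

/-- A geometric point lies on the `F`-rational line with coefficient vector `a`. -/
def OnLine (a : Fin 3 → F) (P : ProjPlane (AlgebraicClosure F)) : Prop :=
  ∑ i, algebraMap F (AlgebraicClosure F) (a i) * P.rep i = 0

/-- The plane curve defined by `f` is smooth: the gradient of `f` is nonzero at every
geometric point of the curve. -/
def SmoothCurve (f : MvPolynomial (Fin 3) F) : Prop :=
  ∀ P : ProjPlane (AlgebraicClosure F), OnCurve f P → ∃ i, aeval P.rep (pderiv i f) ≠ 0

/-- The `F`-line with coefficients `a` meets the curve defined by `f` transversely: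
the intersection consists of exactly `d` distinct geometric points. -/
def Transverse (f : MvPolynomial (Fin 3) F) (a : Fin 3 → F) (d : ℕ) : Prop :=
  {P : ProjPlane (AlgebraicClosure F) | OnCurve f P ∧ OnLine a P}.ncard = d

/-- The restriction of `f` to the line `t ↦ v + t • w`, as a univariate polynomial. -/
def LinePoly (f : MvPolynomial (Fin 3) F) (v w : Fin 3 → AlgebraicClosure F) :
    Polynomial (AlgebraicClosure F) :=
  aeval (fun i => Polynomial.C (v i) + Polynomial.X * Polynomial.C (w i)) f

/-- `P` is a flex point of the curve defined by `f`: the tangent line at `P` meets the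
curve at `P` with intersection multiplicity at least 3. The tangent line is parametrized
through `P.rep` and a direction `w` lying on the tangent line, independent from `P.rep`. -/
def IsFlex (f : MvPolynomial (Fin 3) F) (P : ProjPlane (AlgebraicClosure F)) : Prop :=
  OnCurve f P ∧ ∃ w : Fin 3 → AlgebraicClosure F,
    (¬ ∃ c : AlgebraicClosure F, w = c • P.rep) ∧
    (∑ i, aeval P.rep (pderiv i f) * w i = 0) ∧
    (Polynomial.X : Polynomial (AlgebraicClosure F)) ^ 3 ∣ LinePoly f P.rep w

/-- The `F`-line with coefficients `a` is the tangent line to the curve `f` at the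
geometric point `P`, i.e. `a` is proportional to the gradient of `f` at `P`. -/
def IsTangentAt (f : MvPolynomial (Fin 3) F) (a : Fin 3 → F)
    (P : ProjPlane (AlgebraicClosure F)) : Prop :=
  OnCurve f P ∧ ∃ c : AlgebraicClosure F, c ≠ 0 ∧
    ∀ i, algebraMap F (AlgebraicClosure F) (a i) = c * aeval P.rep (pderiv i f)

/-- The `q`-power Frobenius map on the projective plane. -/
def FrobPt {K : Type*} [Field K] (q : ℕ) (P : ProjPlane K) : ProjPlane K :=
  Projectivization.mk K (fun i => P.rep i ^ q) (by
    intro hc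
    rcases Nat.eq_zero_or_pos q with h0 | h0
    · have := congrFun hc 0
      simp [h0] at this
    · apply P.rep_nonzero
      funext i
      have := congrFun hc i
      simp only [Pi.zero_apply] at this ⊢
      exact pow_eq_zero_iff h0.ne' |>.mp this)

/-- A geometric point of the projective plane is `F`-rational. -/
def IsRationalPt (P : ProjPlane (AlgebraicClosure F)) : Prop :=
  ∃ v : Fin 3 → F, v ≠ 0 ∧ ∃ c : AlgebraicClosure F, c ≠ 0 ∧
    ∀ i, P.rep i = c * algebraMap F (AlgebraicClosure F) (v i)

/-- The curve defined by `f` is Frobenius non-classical over `F` (with `q = #F`):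
the image of every geometric point of the curve under the `q`-power Frobenius lies on
the tangent line at that point. -/
def FrobeniusNonClassical (f : MvPolynomial (Fin 3) F) (q : ℕ) : Prop :=
  ∀ P : ProjPlane (AlgebraicClosure F), OnCurve f P →
    ∑ i, aeval P.rep (pderiv i f) * P.rep i ^ q = 0

section LinearAlgebra
variable {K : Type*} [Field K]

theorem exists_completion_of_pair {u v : Fin 3 → K} (h : LinearIndependent K ![u, v]) :
    ∃ w : Fin 3 → K, ∀ z, ∃ s t r : K, z = s • u + t • v + r • w := by
  obtain ⟨w, hw⟩ := exists_linearIndependent_cons_of_lt_finrank h (by simp)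
  refine ⟨w, fun z => ?_⟩
  have hz : z ∈ Submodule.span K (Set.range (Fin.cons w ![u, v] : Fin 3 → Fin 3 → K)) := by
    rw [hw.span_eq_top_of_card_eq_finrank' (by simp)]
    trivial
  obtain ⟨c, hc⟩ := (Submodule.mem_span_range_iff_exists_fun K).1 hz
  refine ⟨c 1, c 2, c 0, ?_⟩
  rw [← hc, Fin.sum_univ_three]
  simp [Fin.cons]
  abel

theorem eq_smul_of_dotProduct_pair_eq_zero {u v a g : Fin 3 → K}
    (h : LinearIndependent K ![u, v]) (ha : a ≠ 0) (hau : a ⬝ᵥ u = 0) (hav : a ⬝ᵥ v = 0)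
    (hgu : g ⬝ᵥ u = 0) (hgv : g ⬝ᵥ v = 0) : ∃ c : K, g = c • a := by
  obtain ⟨w, hw⟩ := exists_completion_of_pair h
  have key : ∀ b : Fin 3 → K, b ⬝ᵥ u = 0 → b ⬝ᵥ v = 0 → b ⬝ᵥ w = 0 → b = 0 := by
    intro b hu hv hbw
    rw [← dotProduct_eq_zero_iff]
    intro z
    obtain ⟨s, t, r, rfl⟩ := hw z
    simp [dotProduct_add, hu, hv, hbw]
  have haw : a ⬝ᵥ w ≠ 0 := fun h0 => ha (key a hau hav h0)
  refine ⟨g ⬝ᵥ w / a ⬝ᵥ w, sub_eq_zero.1 (key _ ?_ ?_ ?_)⟩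
  · simp [sub_dotProduct, hau, hgu]
  · simp [sub_dotProduct, hav, hgv]
  · simp [sub_dotProduct, haw]

theorem exists_eq_add_of_dotProduct_eq_zero {u v a z : Fin 3 → K}
    (h : LinearIndependent K ![u, v]) (ha : a ≠ 0) (hau : a ⬝ᵥ u = 0) (hav : a ⬝ᵥ v = 0)
    (haz : a ⬝ᵥ z = 0) : ∃ s t : K, z = s • u + t • v := by
  obtain ⟨w, hw⟩ := exists_completion_of_pair h
  obtain ⟨s, t, r, rfl⟩ := hw z
  refine ⟨s, t, ?_⟩
  have haw : a ⬝ᵥ w ≠ 0 := by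
    intro h0
    apply ha
    rw [← dotProduct_eq_zero_iff]
    intro z
    obtain ⟨s, t, r, rfl⟩ := hw z
    simp [dotProduct_add, hau, hav, h0]
  have : r = 0 := by simpa [dotProduct_add, hau, hav, haw] using haz
  simp [this]

theorem exists_linearIndependent_pair_of_dotProduct_eq_zero {a v : Fin 3 → K}
    (hv : v ≠ 0) :
    ∃ u, a ⬝ᵥ u = 0 ∧ LinearIndependent K ![u, v] := by
  let φ : (Fin 3 → K) →ₗ[K] K := dotProductBilin K K a
  have h1 : 2 ≤ Module.finrank K (LinearMap.ker φ) := by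
    have h := φ.finrank_range_add_finrank_ker
    have h' : Module.finrank K (LinearMap.range φ) ≤ 1 := by
      simpa using (LinearMap.range φ).finrank_le
    simp only [Module.finrank_fintype_fun_eq_card, Fintype.card_fin] at h
    omega
  have h2 : ¬ LinearMap.ker φ ≤ Submodule.span K {v} := by
    intro h
    have := Submodule.finrank_mono h
    rw [finrank_span_singleton hv] at this
    omega
  obtain ⟨u, hu, huv⟩ := SetLike.not_le_iff_exists.1 h2
  refine ⟨u, hu, ?_⟩
  rw [LinearIndependent.pair_symm_iff, LinearIndependent.pair_iff' hv]
  intro c hc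
  exact huv (Submodule.mem_span_singleton.2 ⟨c, hc⟩)

end LinearAlgebra

section Gradient
variable {σ R : Type*} [CommRing R]

/-- The gradient of `f` at the point `x`. -/
def gradAt (f : MvPolynomial σ R) (x : σ → R) : σ → R := fun i => eval x (pderiv i f)

theorem MvPolynomial.IsHomogeneous.eval_smul {f : MvPolynomial σ R} {n : ℕ}
    (hf : f.IsHomogeneous n) (c : R) (x : σ → R) : eval (c • x) f = c ^ n * eval x f := by
  rw [eval_eq, eval_eq, Finset.mul_sum]
  refine Finset.sum_congr rfl fun m hm => ?_
  have hmn : ∑ i ∈ m.support, m i = n := (hf.degree_eq_sum_deg_support hm).symm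
  simp only [Pi.smul_apply, smul_eq_mul, mul_pow, Finset.prod_mul_distrib,
    Finset.prod_pow_eq_pow_sum, hmn]
  ring

theorem gradAt_smul {f : MvPolynomial σ R} {n : ℕ} (hf : f.IsHomogeneous n) (c : R) (x : σ → R) :
    gradAt f (c • x) = c ^ (n - 1) • gradAt f x := by
  ext i
  simp [gradAt, hf.pderiv.eval_smul]

theorem gradAt_dotProduct_self [Fintype σ] {f : MvPolynomial σ R} {n : ℕ} (hf : f.IsHomogeneous n)
    (x : σ → R) : gradAt f x ⬝ᵥ x = n * eval x f := by
  have := congrArg (eval x) hf.sum_X_mul_pderiv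
  simpa [dotProduct, gradAt, mul_comm] using this

/-- The restriction of `f` to the line `t ↦ u + t • v`. -/
def restrictLine (f : MvPolynomial σ R) (u v : σ → R) : Polynomial R :=
  aeval (fun i => Polynomial.C (u i) + Polynomial.X * Polynomial.C (v i)) f

theorem eval_restrictLine (f : MvPolynomial σ R) (u v : σ → R) (t : R) :
    (restrictLine f u v).eval t = eval (u + t • v) f := by
  rw [restrictLine, ← Polynomial.coe_evalRingHom, map_aeval]
  have : (Polynomial.evalRingHom t).comp (algebraMap R (Polynomial R)) = RingHom.id R := by
    ext; simp
  simp only [this, eval]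
  congr 2
  ext i
  simp [mul_comm t]

theorem derivative_restrictLine [Fintype σ] (f : MvPolynomial σ R) (u v : σ → R) :
    Polynomial.derivative (restrictLine f u v) =
      ∑ i, restrictLine (pderiv i f) u v * Polynomial.C (v i) := by
  classical
  induction f using MvPolynomial.induction_on with
  | C a => simp [restrictLine, MvPolynomial.algHom_C]
  | add f g hf hg =>
    simp only [restrictLine, map_add] at *
    rw [hf, hg, ← Finset.sum_add_distrib]
    simp [add_mul]
  | mul_X f j hf =>
    have hmul : ∀ g : MvPolynomial σ R, restrictLine (g * X j) u v =
        restrictLine g u v * (Polynomial.C (u j) + Polynomial.X * Polynomial.C (v j)) := by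
      intro g
      simp [restrictLine]
    have hpd : ∀ i, restrictLine (pderiv i (f * X j)) u v * Polynomial.C (v i) =
        restrictLine (pderiv i f) u v * Polynomial.C (v i) *
          (Polynomial.C (u j) + Polynomial.X * Polynomial.C (v j)) +
        if i = j then restrictLine f u v * Polynomial.C (v j) else 0 := by
      intro i
      have hadd : ∀ g h : MvPolynomial σ R, restrictLine (g + h) u v =
          restrictLine g u v + restrictLine h u v := fun g h => by simp [restrictLine]
      rw [pderiv_mul, hadd, hmul]
      split_ifs with hij
      · subst hij
        rw [pderiv_X_self, mul_one]
        ring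
      · rw [pderiv_X_of_ne (Ne.symm hij)]
        simp only [mul_zero, restrictLine, map_zero]
        ring
    rw [Finset.sum_congr rfl fun i _ => hpd i, Finset.sum_add_distrib, ← Finset.sum_mul, ← hf, hmul,
      Polynomial.derivative_mul]
    simp

theorem coeff_zero_restrictLine (f : MvPolynomial σ R) (u v : σ → R) :
    (restrictLine f u v).coeff 0 = eval u f := by
  rw [Polynomial.coeff_zero_eq_eval_zero, eval_restrictLine]
  simp

theorem eval_derivative_restrictLine [Fintype σ] (f : MvPolynomial σ R) (u v : σ → R) (t : R) :
    (Polynomial.derivative (restrictLine f u v)).eval t = gradAt f (u + t • v) ⬝ᵥ v := by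
  simp [derivative_restrictLine, Polynomial.eval_finsetSum, eval_restrictLine, dotProduct, gradAt]

theorem coeff_one_restrictLine [Fintype σ] (f : MvPolynomial σ R) (u v : σ → R) :
    (restrictLine f u v).coeff 1 = gradAt f u ⬝ᵥ v := by
  have := eval_derivative_restrictLine f u v 0
  rw [← Polynomial.coeff_zero_eq_eval_zero, Polynomial.coeff_derivative] at this
  simpa using this

theorem natDegree_and_reflect_prod_linear {ι : Type*} (s : Finset ι) (m : ι → ℕ) (u v : ι → R) :
    (∏ i ∈ s, (Polynomial.C (u i) + Polynomial.X * Polynomial.C (v i)) ^ m i).natDegree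
        ≤ ∑ i ∈ s, m i ∧
      Polynomial.reflect (∑ i ∈ s, m i)
        (∏ i ∈ s, (Polynomial.C (u i) + Polynomial.X * Polynomial.C (v i)) ^ m i) =
        ∏ i ∈ s, (Polynomial.C (v i) + Polynomial.X * Polynomial.C (u i)) ^ m i := by
  classical
  have hlin : ∀ a b : R,
      (Polynomial.C a + Polynomial.X * Polynomial.C b).natDegree ≤ 1 := by
    intro a b
    rw [add_comm, mul_comm]
    exact Polynomial.natDegree_linear_le
  have hrefl : ∀ a b : R, Polynomial.reflect 1 (Polynomial.C a + Polynomial.X * Polynomial.C b) =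
      Polynomial.C b + Polynomial.X * Polynomial.C a := by
    intro a b
    rw [Polynomial.reflect_add, Polynomial.reflect_C, mul_comm Polynomial.X (Polynomial.C b),
      Polynomial.reflect_C_mul, ← pow_one (Polynomial.X : Polynomial R),
      Polynomial.reflect_monomial]
    rw [Polynomial.revAt_le le_rfl, pow_one, Nat.sub_self, pow_zero, mul_one, add_comm,
      mul_comm (Polynomial.C a)]
  have hpow : ∀ (a b : R) (n : ℕ),
      ((Polynomial.C a + Polynomial.X * Polynomial.C b) ^ n).natDegree ≤ n := fun a b n =>
    Polynomial.natDegree_pow_le_of_le n (hlin a b) |>.trans (by simp)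
  have hreflpow : ∀ (a b : R) (n : ℕ),
      Polynomial.reflect n ((Polynomial.C a + Polynomial.X * Polynomial.C b) ^ n) =
        (Polynomial.C b + Polynomial.X * Polynomial.C a) ^ n := by
    intro a b n
    induction n with
    | zero => simp [Polynomial.reflect_one]
    | succ n ih => rw [pow_succ, Polynomial.reflect_mul _ _ (hpow a b n) (hlin a b), ih, hrefl,
        pow_succ]
  induction s using Finset.induction_on with
  | empty => simp [Polynomial.reflect_one]
  | insert i s hi ih =>
    simp only [Finset.prod_insert hi, Finset.sum_insert hi]
    refine ⟨Polynomial.natDegree_mul_le.trans (add_le_add (hpow _ _ _) ih.1), ?_⟩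
    rw [Polynomial.reflect_mul _ _ (hpow _ _ _) ih.1, hreflpow, ih.2]

theorem restrictLine_eq_sum (f : MvPolynomial σ R) (u v : σ → R) :
    restrictLine f u v = ∑ m ∈ f.support, Polynomial.C (f.coeff m) *
      ∏ i ∈ m.support, (Polynomial.C (u i) + Polynomial.X * Polynomial.C (v i)) ^ m i := by
  rw [restrictLine, aeval_def, eval₂_eq]
  rfl

theorem natDegree_restrictLine_le {f : MvPolynomial σ R} {n : ℕ} (hf : f.IsHomogeneous n)
    (u v : σ → R) : (restrictLine f u v).natDegree ≤ n := by
  rw [restrictLine_eq_sum]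
  refine Polynomial.natDegree_sum_le_of_forall_le _ _ fun m hm => ?_
  rw [hf.degree_eq_sum_deg_support hm]
  exact (Polynomial.natDegree_C_mul_le _ _).trans (natDegree_and_reflect_prod_linear _ _ _ _).1

theorem reflect_restrictLine {f : MvPolynomial σ R} {n : ℕ} (hf : f.IsHomogeneous n)
    (u v : σ → R) : Polynomial.reflect n (restrictLine f u v) = restrictLine f v u := by
  rw [restrictLine_eq_sum, restrictLine_eq_sum]
  have hsum : ∀ (s : Finset (σ →₀ ℕ)) (g : (σ →₀ ℕ) → Polynomial R),
      Polynomial.reflect n (∑ m ∈ s, g m) = ∑ m ∈ s, Polynomial.reflect n (g m) := by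
    classical
    intro s g
    induction s using Finset.induction_on with
    | empty => simp
    | insert i s hi ih =>
      rw [Finset.sum_insert hi, Finset.sum_insert hi, Polynomial.reflect_add, ih]
  rw [hsum]
  refine Finset.sum_congr rfl fun m hm => ?_
  rw [hf.degree_eq_sum_deg_support hm, Polynomial.reflect_C_mul,
    (natDegree_and_reflect_prod_linear _ _ _ _).2]

theorem coeff_restrictLine_swap {f : MvPolynomial σ R} {n : ℕ} (hf : f.IsHomogeneous n)
    (u v : σ → R) {k : ℕ} (hk : k ≤ n) :
    (restrictLine f u v).coeff (n - k) = (restrictLine f v u).coeff k := by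
  rw [← reflect_restrictLine hf u v, Polynomial.coeff_reflect, Polynomial.revAt_le hk]

theorem coeff_top_restrictLine {f : MvPolynomial σ R} {n : ℕ} (hf : f.IsHomogeneous n)
    (u v : σ → R) : (restrictLine f u v).coeff n = eval v f := by
  simpa [coeff_zero_restrictLine] using coeff_restrictLine_swap hf u v (Nat.zero_le n)

theorem coeff_pred_restrictLine [Fintype σ] {f : MvPolynomial σ R} {n : ℕ} (hf : f.IsHomogeneous n)
    (hn : 1 ≤ n) (u v : σ → R) : (restrictLine f u v).coeff (n - 1) = gradAt f v ⬝ᵥ u := by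
  rw [coeff_restrictLine_swap hf u v hn, coeff_one_restrictLine]

end Gradient

section Graded
variable {K : Type*} [Field K]

instance (n : ℕ) : Module.Finite K (homogeneousSubmodule (Fin 3) K n) :=
  Module.Finite.iff_fg.2 (homogeneousSubmodule_fg (Fin 3) K n)

theorem finrank_homogeneousSubmodule_fin_three (n : ℕ) :
    2 * Module.finrank K (homogeneousSubmodule (Fin 3) K n) = (n + 2) * (n + 1) := by
  classical
  have h1 : Module.finrank K (homogeneousSubmodule (Fin 3) K n) = (2 + n).choose n := by
    rw [homogeneousSubmodule_eq_finsupp_supported,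
      (AddMonoidAlgebra.supportedEquivFinsupp _).finrank_eq]
    have hs : {m : Fin 3 →₀ ℕ | m.degree = n} =
        ((Finset.univ : Finset (Fin 3)).finsuppAntidiag n : Set (Fin 3 →₀ ℕ)) := by
      ext m
      simp [Finsupp.degree_eq_sum]
    rw [hs, Module.finrank_finsupp_self, ← Nat.card_eq_fintype_card, Nat.card_coe_set_eq,
      Set.ncard_coe_finset, Finset.card_finsuppAntidiag_nat_eq_choose]
    simp only [Finset.card_univ, Fintype.card_fin]
    congr 1
    omega
  rw [h1, add_comm 2 n, Nat.choose_symm_add, Nat.choose_two_right, mul_comm, Nat.div_mul_cancel]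
  · simp [mul_comm]
  · exact (Nat.even_mul_pred_self _).two_dvd

theorem homogeneousComponent_mul_of_isHomogeneous {σ R : Type*} [CommRing R]
    {f : MvPolynomial σ R} {a : ℕ} (hf : f.IsHomogeneous a) (n : ℕ) (g : MvPolynomial σ R) :
    homogeneousComponent (a + n) (f * g) = f * homogeneousComponent n g := by
  let := MvPolynomial.gradedAlgebra (σ := σ) (R := R)
  have h := DirectSum.coe_decompose_mul_add_of_left_mem (homogeneousSubmodule σ R) (i := a) (j := n)
    (a := f) (b := g) hf
  rw [← decomposition.decompose'_apply, ← decomposition.decompose'_apply]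
  exact h

theorem homogeneousComponent_totalDegree_mul {σ R : Type*} [CommRing R] (s t : MvPolynomial σ R) :
    homogeneousComponent (s.totalDegree + t.totalDegree) (s * t) =
      homogeneousComponent s.totalDegree s * homogeneousComponent t.totalDegree t := by
  have hterm : ∀ i ∈ Finset.range (s.totalDegree + 1),
      homogeneousComponent (s.totalDegree + t.totalDegree) (homogeneousComponent i s * t) =
        homogeneousComponent i s *
          homogeneousComponent (s.totalDegree + t.totalDegree - i) t := by
    intro i hi
    rw [← homogeneousComponent_mul_of_isHomogeneous (homogeneousComponent_isHomogeneous i s)]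
    congr 2
    rw [Finset.mem_range] at hi
    omega
  conv_lhs => rw [← sum_homogeneousComponent s, Finset.sum_mul, map_sum]
  rw [sum_homogeneousComponent s, Finset.sum_congr rfl hterm, Finset.sum_range_succ,
    Finset.sum_eq_zero, zero_add, Nat.add_sub_cancel_left]
  intro i hi
  rw [homogeneousComponent_eq_zero _ t, mul_zero]
  rw [Finset.mem_range] at hi
  omega

theorem MvPolynomial.IsHomogeneous.of_mul_left {σ : Type*} {f g : MvPolynomial σ K} {a n : ℕ}
    (hf : f.IsHomogeneous a) (hf0 : f ≠ 0) (hfg : (f * g).IsHomogeneous (a + n)) :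
    g.IsHomogeneous n := by
  have h := homogeneousComponent_mul_of_isHomogeneous hf n g
  rw [homogeneousComponent_eq_self hfg] at h
  rw [mul_left_cancel₀ hf0 h]
  exact homogeneousComponent_isHomogeneous n g

/-- Multiplication by a form `f` of degree `a`, from forms of degree `n` to forms of degree `m`. -/
def mulForm {f : MvPolynomial (Fin 3) K} {a n m : ℕ} (hf : f.IsHomogeneous a) (h : a + n = m) :
    homogeneousSubmodule (Fin 3) K n →ₗ[K] homogeneousSubmodule (Fin 3) K m :=
  (LinearMap.mulLeft K f).restrict fun _ hx => h ▸ hf.mul hx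

/-- The map `(s, t) ↦ f s + g t` onto the degree `a + b + k` part of the ideal `(f, g)`. -/
def idealForm {f g : MvPolynomial (Fin 3) K} {a b : ℕ} (hf : f.IsHomogeneous a)
    (hg : g.IsHomogeneous b) (k : ℕ) :
    homogeneousSubmodule (Fin 3) K (b + k) × homogeneousSubmodule (Fin 3) K (a + k) →ₗ[K]
      homogeneousSubmodule (Fin 3) K (a + b + k) :=
  (mulForm hf (add_assoc a b k).symm).coprod (mulForm hg (by omega))

/-- The Koszul syzygies `c ↦ (-g c, f c)`. -/
def koszulForm {f g : MvPolynomial (Fin 3) K} {a b : ℕ} (hf : f.IsHomogeneous a)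
    (hg : g.IsHomogeneous b) (k : ℕ) :
    homogeneousSubmodule (Fin 3) K k →ₗ[K]
      homogeneousSubmodule (Fin 3) K (b + k) × homogeneousSubmodule (Fin 3) K (a + k) :=
  (-mulForm hg rfl).prod (mulForm hf rfl)

variable {f g : MvPolynomial (Fin 3) K} {a b : ℕ}

theorem finrank_range_idealForm (hf : f.IsHomogeneous a) (hg : g.IsHomogeneous b) (k : ℕ) :
    2 * Module.finrank K (LinearMap.range (idealForm hf hg k)) +
      2 * Module.finrank K (LinearMap.ker (idealForm hf hg k)) =
      (b + k + 2) * (b + k + 1) + (a + k + 2) * (a + k + 1) := by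
  have h := (idealForm hf hg k).finrank_range_add_finrank_ker
  rw [Module.finrank_prod] at h
  rw [← finrank_homogeneousSubmodule_fin_three (K := K),
    ← finrank_homogeneousSubmodule_fin_three (K := K), ← mul_add, ← mul_add, h]

/-- If `f` and `g` have no common factor then `(f, g)` has codimension at most `a * b` in
large degrees. -/
theorem finrank_le_finrank_range_idealForm_add (hf : f.IsHomogeneous a) (hg : g.IsHomogeneous b)
    (hf0 : f ≠ 0) (hfg : ∀ h, f ∣ g * h → f ∣ h) (k : ℕ) :
    Module.finrank K (homogeneousSubmodule (Fin 3) K (a + b + k)) ≤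
      Module.finrank K (LinearMap.range (idealForm hf hg k)) + a * b := by
  have hker : LinearMap.ker (idealForm hf hg k) ≤ LinearMap.range (koszulForm hf hg k) := by
    rintro ⟨⟨s, hs⟩, ⟨t, ht⟩⟩ hst
    have hst : f * s + g * t = 0 := congrArg Subtype.val (LinearMap.mem_ker.1 hst)
    obtain ⟨c, rfl⟩ := hfg t ⟨-s, by linear_combination hst⟩
    have hc : c.IsHomogeneous k := hf.of_mul_left hf0 ht
    refine ⟨⟨c, hc⟩, Prod.ext (Subtype.ext ?_) (Subtype.ext rfl)⟩
    change -(g * c) = s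
    refine mul_left_cancel₀ hf0 ?_
    linear_combination -hst
  have h1 := (Submodule.finrank_mono hker).trans (koszulForm hf hg k).finrank_range_le
  have h2 := finrank_range_idealForm hf hg k
  have h3 := finrank_homogeneousSubmodule_fin_three (K := K) k
  have h4 := finrank_homogeneousSubmodule_fin_three (K := K) (a + b + k)
  nlinarith

theorem finrank_range_idealForm_add_le (hf : f.IsHomogeneous a) (hg : g.IsHomogeneous b)
    (hf0 : f ≠ 0) (k : ℕ) :
    Module.finrank K (LinearMap.range (idealForm hf hg k)) + a * b ≤
      Module.finrank K (homogeneousSubmodule (Fin 3) K (a + b + k)) := by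
  have hker : LinearMap.range (koszulForm hf hg k) ≤ LinearMap.ker (idealForm hf hg k) := by
    rintro _ ⟨c, rfl⟩
    refine LinearMap.mem_ker.2 (Subtype.ext ?_)
    change f * -(g * c) + g * (f * c) = 0
    ring
  have hinj : Function.Injective (koszulForm hf hg k) := by
    intro c c' h
    have h : f * (c : MvPolynomial (Fin 3) K) = f * c' :=
      congrArg Subtype.val (congrArg Prod.snd h)
    exact Subtype.ext (mul_left_cancel₀ hf0 h)
  have h1 := Submodule.finrank_mono hker
  rw [LinearMap.finrank_range_of_inj hinj] at h1
  have h2 := finrank_range_idealForm hf hg k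
  have h3 := finrank_homogeneousSubmodule_fin_three (K := K) k
  have h4 := finrank_homogeneousSubmodule_fin_three (K := K) (a + b + k)
  nlinarith

/-- Two plane curves of positive degree over an algebraically closed field meet. -/
theorem exists_common_zero [IsAlgClosed K] (hf : f.IsHomogeneous a) (hg : g.IsHomogeneous b)
    (ha : 0 < a) (hb : 0 < b) : ∃ x : Fin 3 → K, x ≠ 0 ∧ eval x f = 0 ∧ eval x g = 0 := by
  by_contra! hcon
  have hf0 : f ≠ 0 := by
    rintro rfl
    obtain ⟨x, hx, hgx⟩ : ∃ x : Fin 3 → K, x ≠ 0 ∧ eval x g = 0 := by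
      by_cases h0 : eval ![0, 1, 0] g = 0
      · exact ⟨_, by simp, h0⟩
      · have hdeg : (restrictLine g ![1, 0, 0] ![0, 1, 0]).degree ≠ 0 := by
          intro hd
          have := Polynomial.coeff_eq_zero_of_degree_lt
            (hd.trans_lt (by exact_mod_cast hb : (0 : WithBot ℕ) < b))
          exact h0 (by rwa [coeff_top_restrictLine hg] at this)
        obtain ⟨t, ht⟩ := IsAlgClosed.exists_root _ hdeg
        refine ⟨![1, 0, 0] + t • ![0, 1, 0], fun h => ?_, ?_⟩
        · simpa using congrFun h 0
        · rw [← eval_restrictLine]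
          exact ht
    exact hcon x hx (by simp) hgx
  let I : Ideal (MvPolynomial (Fin 3) K) := Ideal.span {f, g}
  have hrad : idealOfVars (Fin 3) K ≤ I.radical := by
    rw [← vanishingIdeal_zeroLocus_eq_radical (K := K), idealOfVars, Ideal.span_le]
    rintro _ ⟨i, rfl⟩ x hx
    rw [zeroLocus_span] at hx
    have hfx : eval x f = 0 := by simpa [aeval_eq_eval] using hx f (by simp)
    have hgx : eval x g = 0 := by simpa [aeval_eq_eval] using hx g (by simp)
    have : x = 0 := by
      by_contra h0
      exact hcon x h0 hfx hgx
    simp [this]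
  obtain ⟨N, hN⟩ := Ideal.exists_pow_le_of_le_radical_of_fg hrad (idealOfVars_fg (Fin 3) K)
  have htop : LinearMap.range (idealForm hf hg N) = ⊤ := by
    rw [eq_top_iff]
    rintro ⟨s, hs⟩ -
    have hsI : s ∈ I := by
      refine hN ((mem_pow_idealOfVars_iff' _ _).2 fun m hm => hs.coeff_eq_zero ?_)
      omega
    obtain ⟨s', t', hst⟩ := Ideal.mem_span_pair.1 hsI
    refine ⟨⟨⟨homogeneousComponent (b + N) s', homogeneousComponent_isHomogeneous _ _⟩,
      ⟨homogeneousComponent (a + N) t', homogeneousComponent_isHomogeneous _ _⟩⟩, Subtype.ext ?_⟩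
    change f * homogeneousComponent (b + N) s' + g * homogeneousComponent (a + N) t' = s
    rw [← homogeneousComponent_mul_of_isHomogeneous hf,
      ← homogeneousComponent_mul_of_isHomogeneous hg,
      show b + (a + N) = a + (b + N) by omega, ← map_add, mul_comm f, mul_comm g, hst,
      homogeneousComponent_eq_self (by rwa [← add_assoc])]
  have := finrank_range_idealForm_add_le hf hg hf0 N
  rw [htop, finrank_top] at this
  have := Nat.mul_pos ha hb
  omega

/-- A nonsingular plane curve is irreducible. -/
theorem irreducible_of_gradAt_ne_zero [IsAlgClosed K] (hf : f.IsHomogeneous a) (hf0 : f ≠ 0)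
    (ha : 0 < a) (hsm : ∀ x ≠ 0, eval x f = 0 → gradAt f x ≠ 0) : Irreducible f := by
  have htd := hf.totalDegree hf0
  constructor
  · intro hu
    obtain ⟨r, hr, rfl⟩ := MvPolynomial.isUnit_iff_eq_C_of_isReduced.1 hu
    simp at htd
    omega
  · intro s t hst
    by_contra! hcon
    have hs0 : s ≠ 0 := by rintro rfl; simp_all
    have ht0 : t ≠ 0 := by rintro rfl; simp_all
    have hpos : ∀ r : MvPolynomial (Fin 3) K, r ≠ 0 → ¬ IsUnit r → 0 < r.totalDegree := by
      intro r hr hu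
      by_contra h
      have := (totalDegree_eq_zero_iff_eq_C (p := r)).1 (by omega)
      refine hu ?_
      rw [this]
      refine IsUnit.map C (IsUnit.mk0 _ fun h0 => hr ?_)
      rw [this, h0, C_0]
    have hdeg : s.totalDegree + t.totalDegree = a := by
      rw [← totalDegree_mul_of_isDomain hs0 ht0, ← hst, htd]
    obtain ⟨x, hx0, hxs, hxt⟩ := exists_common_zero
      (homogeneousComponent_isHomogeneous s.totalDegree s)
      (homogeneousComponent_isHomogeneous t.totalDegree t) (hpos s hs0 hcon.1) (hpos t ht0 hcon.2)
    have hprod : f =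
        homogeneousComponent s.totalDegree s * homogeneousComponent t.totalDegree t := by
      rw [← homogeneousComponent_totalDegree_mul, hdeg, ← hst, homogeneousComponent_eq_self hf]
    refine hsm x hx0 (by rw [hprod, map_mul, hxs, zero_mul]) ?_
    ext i
    rw [gradAt, hprod, pderiv_mul, map_add, map_mul, map_mul, hxs, hxt]
    simp

end Graded

section Interpolation
variable {K : Type*} [Field K]

/-- The linear form with coefficient vector `c`. -/
def linForm (c : Fin 3 → K) : MvPolynomial (Fin 3) K := ∑ i, C (c i) * X i

theorem isHomogeneous_linForm (c : Fin 3 → K) : (linForm c).IsHomogeneous 1 :=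
  IsHomogeneous.sum _ _ _ fun _ _ => isHomogeneous_C_mul_X _ _

@[simp]
theorem eval_linForm (c x : Fin 3 → K) : eval x (linForm c) = c ⬝ᵥ x := by
  simp [linForm, dotProduct]

@[simp]
theorem gradAt_linForm (c x : Fin 3 → K) : gradAt (linForm c) x = c := by
  ext i
  simp [gradAt, linForm, pderiv_X, Pi.single_apply]

theorem gradAt_mul (f g : MvPolynomial (Fin 3) K) (x : Fin 3 → K) :
    gradAt (f * g) x = eval x g • gradAt f x + eval x f • gradAt g x := by
  ext i
  simp only [gradAt, pderiv_mul, map_add, map_mul, Pi.add_apply, Pi.smul_apply, smul_eq_mul]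
  ring

theorem exists_dotProduct_eq_one_of_linearIndependent {x y : Fin 3 → K}
    (h : LinearIndependent K ![x, y]) : ∃ c : Fin 3 → K, c ⬝ᵥ x = 1 ∧ c ⬝ᵥ y = 0 := by
  have hy : y ≠ 0 := h.ne_zero 1
  have hx : x ∉ Submodule.span K {y} := by
    intro hx
    obtain ⟨c, hc⟩ := Submodule.mem_span_singleton.1 hx
    rw [LinearIndependent.pair_symm_iff, LinearIndependent.pair_iff' hy] at h
    exact h c hc
  obtain ⟨φ, hφx, hφy⟩ := Submodule.exists_le_ker_of_notMem hx
  have hφ : ∀ z, φ z = (fun i => φ (Pi.single i 1)) ⬝ᵥ z := by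
    intro z
    conv_lhs => rw [← Finset.univ_sum_single z, map_sum]
    refine Finset.sum_congr rfl fun i _ => ?_
    rw [mul_comm, ← smul_eq_mul, ← map_smul, ← Pi.single_smul]
    simp
  refine ⟨(φ x)⁻¹ • fun i => φ (Pi.single i 1), ?_, ?_⟩
  · rw [smul_dotProduct, ← hφ, smul_eq_mul, inv_mul_cancel₀ hφx]
  · have hy0 : φ y = 0 := hφy (Submodule.mem_span_singleton_self y)
    rw [smul_dotProduct, ← hφ, hy0, smul_zero]

theorem exists_dotProduct_eq_one {x : Fin 3 → K} (h : x ≠ 0) : ∃ c : Fin 3 → K, c ⬝ᵥ x = 1 := by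
  obtain ⟨i, hi⟩ := Function.ne_iff.1 h
  exact ⟨Pi.single i (x i)⁻¹, by simpa using inv_mul_cancel₀ hi⟩

variable {ι : Type*} [Fintype ι] [DecidableEq ι]

theorem exists_form_eval_eq_single {x : ι → Fin 3 → K} (hx0 : ∀ i, x i ≠ 0)
    (hx : ∀ i j, i ≠ j → LinearIndependent K ![x i, x j]) (i : ι) {m : ℕ}
    (hm : Fintype.card ι ≤ m) :
    ∃ G : MvPolynomial (Fin 3) K,
      G.IsHomogeneous m ∧ ∀ j, eval (x j) G = if j = i then 1 else 0 := by
  obtain ⟨e, he⟩ := exists_dotProduct_eq_one (hx0 i)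
  have hc : ∀ j, ∃ c : Fin 3 → K, c ⬝ᵥ x i = 1 ∧ (j ≠ i → c ⬝ᵥ x j = 0) := by
    intro j
    by_cases hj : j = i
    · exact ⟨e, he, fun h => absurd hj h⟩
    · obtain ⟨c, hc1, hc2⟩ := exists_dotProduct_eq_one_of_linearIndependent (hx i j (Ne.symm hj))
      exact ⟨c, hc1, fun _ => hc2⟩
  choose c hc1 hc2 using hc
  refine ⟨(∏ j, linForm (c j)) * linForm e ^ (m - Fintype.card ι), ?_, fun j => ?_⟩
  · have h1 := IsHomogeneous.prod Finset.univ (fun j => linForm (c j)) (fun _ => 1)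
      fun j _ => isHomogeneous_linForm (c j)
    have h2 := h1.mul ((isHomogeneous_linForm e).pow (m - Fintype.card ι))
    convert! h2 using 1
    simp
    omega
  · split_ifs with hj
    · subst hj
      simp [map_prod, hc1, he]
    · rw [map_mul, map_prod, Finset.prod_eq_zero (Finset.mem_univ j), zero_mul]
      simp [hc2 j hj]

theorem exists_form_gradAt_eq_single {x w : ι → Fin 3 → K}
    (hx : ∀ i j, i ≠ j → LinearIndependent K ![x i, x j]) (i : ι)
    (hw : LinearIndependent K ![w i, x i]) {m : ℕ} (hm : 2 * Fintype.card ι + 1 ≤ m) :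
    ∃ G : MvPolynomial (Fin 3) K, G.IsHomogeneous m ∧ (∀ j, eval (x j) G = 0) ∧
      ∀ j, gradAt G (x j) ⬝ᵥ w j = if j = i then 1 else 0 := by
  obtain ⟨l, hlw, hlx⟩ := exists_dotProduct_eq_one_of_linearIndependent hw
  have hx0 : ∀ j, j ≠ i → x j ≠ 0 := fun j hj => (hx j i hj).ne_zero 0
  obtain ⟨G, hG, hGx⟩ := exists_form_eval_eq_single (x := x) (m := Fintype.card ι)
    (fun j => if hj : j = i then by subst hj; exact hw.ne_zero 1 else hx0 j hj) hx i le_rfl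
  obtain ⟨e, he⟩ := exists_dotProduct_eq_one (x := x i) (hw.ne_zero 1)
  refine ⟨linForm l * (G * (G * linForm e ^ (m - 2 * Fintype.card ι - 1))), ?_, fun j => ?_,
    fun j => ?_⟩
  · have h2 := (isHomogeneous_linForm l).mul
      (hG.mul (hG.mul ((isHomogeneous_linForm e).pow (m - 2 * Fintype.card ι - 1))))
    convert! h2 using 1
    omega
  · by_cases hj : j = i
    · subst hj
      simp [hlx]
    · simp [hGx, hj]
  · rw [gradAt_mul]
    split_ifs with hj
    · subst hj
      simp [hlx, hGx, he, hlw]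
    · rw [gradAt_mul]
      simp [hGx, hj]

/-- Evaluation at a family of points, as a linear map. -/
def evalAt {κ : Type*} (x : κ → Fin 3 → K) : MvPolynomial (Fin 3) K →ₗ[K] κ → K :=
  LinearMap.pi fun i => (aeval (x i)).toLinearMap

/-- Derivatives at a family of points along a family of directions, as a linear map. -/
def derivAlong {κ : Type*} (x w : κ → Fin 3 → K) : MvPolynomial (Fin 3) K →ₗ[K] κ → K where
  toFun G i := gradAt G (x i) ⬝ᵥ w i
  map_add' G H := by
    ext i
    simp [gradAt, dotProduct, add_mul, Finset.sum_add_distrib]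
  map_smul' c G := by
    ext i
    simp [gradAt, dotProduct, smul_eval, Finset.mul_sum, mul_assoc]

@[simp]
theorem evalAt_apply {κ : Type*} (x : κ → Fin 3 → K) (G : MvPolynomial (Fin 3) K) (i : κ) :
    evalAt x G i = eval (x i) G := rfl

@[simp]
theorem derivAlong_apply {κ : Type*} (x w : κ → Fin 3 → K) (G : MvPolynomial (Fin 3) K) (i : κ) :
    derivAlong x w G i = gradAt G (x i) ⬝ᵥ w i := rfl

theorem sum_smul_single (u : ι → K) : ∑ i, u i • (Pi.single i 1 : ι → K) = u := by
  ext j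
  simp [Pi.single_apply]

theorem surjective_prod_of_single {V κ : Type*} [AddCommGroup V] [Module K V] [Fintype κ]
    [DecidableEq κ] (A : V →ₗ[K] ι → K) (B : V →ₗ[K] κ → K) (E : ι → V) (D : κ → V)
    (hE : ∀ i, A (E i) = Pi.single i 1) (hA : ∀ j, A (D j) = 0)
    (hB : ∀ j, B (D j) = Pi.single j 1) : Function.Surjective (A.prod B) := by
  rintro ⟨u, v⟩
  obtain ⟨G, hG⟩ : ∃ G, A G = u := ⟨∑ i, u i • E i, by
    simp only [map_sum, map_smul, hE, sum_smul_single]⟩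
  refine ⟨G + ∑ j, (v - B G) j • D j, Prod.ext ?_ ?_⟩
  · change A (G + ∑ j, (v - B G) j • D j) = u
    simp only [map_add, map_sum, map_smul, hA, hG, smul_zero, Finset.sum_const_zero, add_zero]
  · change B (G + ∑ j, (v - B G) j • D j) = v
    rw [map_add, map_sum]
    simp only [map_smul, hB]
    rw [sum_smul_single, add_sub_cancel]

/-- Evaluation at the points of a family together with derivatives at the points of a subfamily,
on forms of a fixed degree. -/
def jetMap (x w : ι → Fin 3 → K) (T : Finset ι) (m : ℕ) :
    homogeneousSubmodule (Fin 3) K m →ₗ[K] (ι → K) × (T → K) :=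
  ((evalAt x).domRestrict _).prod
    ((derivAlong (fun i : T => x i) fun i : T => w i).domRestrict _)

theorem surjective_jetMap {x w : ι → Fin 3 → K} {T : Finset ι} (hx0 : ∀ i, x i ≠ 0)
    (hx : ∀ i j, i ≠ j → LinearIndependent K ![x i, x j])
    (hw : ∀ i ∈ T, LinearIndependent K ![w i, x i]) {m : ℕ} (hm : 2 * Fintype.card ι + 1 ≤ m) :
    Function.Surjective (jetMap x w T m) := by
  have hE := fun i => exists_form_eval_eq_single hx0 hx i (m := m) (by omega)
  choose E hE hEx using hE
  have hD := fun i : T => exists_form_gradAt_eq_single hx i.1 (hw i.1 i.2) hm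
  choose D hD hDx hDw using hD
  let E' : ι → homogeneousSubmodule (Fin 3) K m := fun i => ⟨E i, hE i⟩
  let D' : T → homogeneousSubmodule (Fin 3) K m := fun i => ⟨D i, hD i⟩
  refine surjective_prod_of_single _ _ E' D' (fun i => ?_) (fun i => ?_) (fun i => ?_)
  · ext j
    rw [LinearMap.domRestrict_apply, evalAt_apply, hEx, Pi.single_apply]
  · ext j
    rw [LinearMap.domRestrict_apply, evalAt_apply, hDx, Pi.zero_apply]
  · ext j
    rw [LinearMap.domRestrict_apply, derivAlong_apply, hDw, Pi.single_apply]
    simp only [Subtype.ext_iff]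

/-- Bézout's inequality for plane curves without common factor, where the points of `T` at which
the curves share a tangent direction are counted twice. -/
theorem card_add_card_le_mul {f g : MvPolynomial (Fin 3) K} {a b : ℕ} (hf : f.IsHomogeneous a)
    (hg : g.IsHomogeneous b) (hf0 : f ≠ 0) (hfg : ∀ h, f ∣ g * h → f ∣ h)
    {x w : ι → Fin 3 → K} (T : Finset ι) (hx0 : ∀ i, x i ≠ 0)
    (hx : ∀ i j, i ≠ j → LinearIndependent K ![x i, x j])
    (hw : ∀ i ∈ T, LinearIndependent K ![w i, x i])
    (hfx : ∀ i, eval (x i) f = 0) (hgx : ∀ i, eval (x i) g = 0)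
    (hfw : ∀ i ∈ T, gradAt f (x i) ⬝ᵥ w i = 0) (hgw : ∀ i ∈ T, gradAt g (x i) ⬝ᵥ w i = 0) :
    Fintype.card ι + T.card ≤ a * b := by
  obtain ⟨k, hk⟩ : ∃ k, k = 2 * Fintype.card ι + 1 := ⟨_, rfl⟩
  have hsurj : LinearMap.range (jetMap x w T (a + b + k)) = ⊤ :=
    LinearMap.range_eq_top.2 (surjective_jetMap hx0 hx hw (by omega))
  have hker : LinearMap.range (idealForm hf hg k) ≤ LinearMap.ker (jetMap x w T (a + b + k)) := by
    rintro _ ⟨⟨⟨s, hs⟩, ⟨t, ht⟩⟩, rfl⟩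
    refine LinearMap.mem_ker.2 (Prod.ext (funext fun i => ?_) (funext fun i => ?_))
    · change eval (x i) (f * s + g * t) = 0
      simp [hfx, hgx]
    · change gradAt (f * s + g * t) (x i) ⬝ᵥ w i = 0
      have hadd : gradAt (f * s + g * t) (x i) = gradAt (f * s) (x i) + gradAt (g * t) (x i) := by
        ext; simp [gradAt]
      rw [hadd, gradAt_mul, gradAt_mul]
      simp [add_dotProduct, hfx, hgx, hfw i i.2, hgw i i.2]
  have h1 := (jetMap x w T (a + b + k)).finrank_range_add_finrank_ker
  rw [hsurj, finrank_top, Module.finrank_prod, Module.finrank_fintype_fun_eq_card,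
    Module.finrank_fintype_fun_eq_card, Fintype.card_coe] at h1
  have h2 := Submodule.finrank_mono hker
  have h3 := finrank_le_finrank_range_idealForm_add hf hg hf0 hfg k
  omega

end Interpolation

section Lines
variable {K : Type*} [Field K] [IsAlgClosed K] {f : MvPolynomial (Fin 3) K} {d : ℕ}

theorem restrictLine_ne_zero (hf : f.IsHomogeneous d) (hd : 2 ≤ d)
    (hsm : ∀ x ≠ 0, eval x f = 0 → gradAt f x ≠ 0) {x y : Fin 3 → K}
    (h : LinearIndependent K ![x, y]) : restrictLine f x y ≠ 0 := by
  intro h0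
  obtain ⟨w, hw⟩ := exists_completion_of_pair h
  have key : ∀ b : Fin 3 → K, b ⬝ᵥ x = 0 → b ⬝ᵥ y = 0 → b ⬝ᵥ w = 0 → b = 0 := by
    intro b hu hv hbw
    rw [← dotProduct_eq_zero_iff]
    intro z
    obtain ⟨s, t, r, rfl⟩ := hw z
    simp [dotProduct_add, hu, hv, hbw]
  have hfy : eval y f = 0 := by rw [← coeff_top_restrictLine hf x y, h0, Polynomial.coeff_zero]
  have hft : ∀ t : K, eval (x + t • y) f = 0 := fun t => by
    rw [← eval_restrictLine, h0, Polynomial.eval_zero]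
  have hgy : ∀ t : K, gradAt f (x + t • y) ⬝ᵥ y = 0 := fun t => by
    rw [← eval_derivative_restrictLine, h0, Polynomial.derivative_zero, Polynomial.eval_zero]
  have hgx : ∀ t : K, gradAt f (x + t • y) ⬝ᵥ x = 0 := fun t => by
    have := gradAt_dotProduct_self hf (x + t • y)
    rwa [hft, mul_zero, dotProduct_add, dotProduct_smul, hgy, smul_zero, add_zero] at this
  obtain ⟨μ, hμ⟩ : ∃ μ, μ = ∑ i, pderiv i f * C (w i) := ⟨_, rfl⟩
  have hμd : μ.IsHomogeneous (d - 1) := hμ ▸ IsHomogeneous.sum _ _ _ fun i _ => by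
    simpa using (hf.pderiv (i := i)).mul (isHomogeneous_C _ (w i))
  have hμe : ∀ z, eval z μ = gradAt f z ⬝ᵥ w := fun z => by
    simp [hμ, dotProduct, gradAt]
  by_cases hdeg : (restrictLine μ x y).degree = 0
  · have hyw : gradAt f y ⬝ᵥ w = 0 := by
      rw [← hμe, ← coeff_top_restrictLine hμd x y]
      apply Polynomial.coeff_eq_zero_of_natDegree_lt
      rw [Polynomial.natDegree_eq_zero_iff_degree_le_zero.2 hdeg.le]
      omega
    refine hsm y (h.ne_zero 1) hfy (key _ ?_ ?_ hyw)
    · rw [← coeff_pred_restrictLine hf (by omega), h0, Polynomial.coeff_zero]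
    · rw [gradAt_dotProduct_self hf, hfy, mul_zero]
  · obtain ⟨t, ht⟩ := IsAlgClosed.exists_root _ hdeg
    rw [Polynomial.IsRoot, eval_restrictLine, hμe] at ht
    refine hsm (x + t • y) (fun hz => ?_) (hft t) (key _ (hgx t) (hgy t) ht)
    have := (LinearIndependent.pair_iff.1 h) 1 t (by simpa using hz)
    exact one_ne_zero this.1

theorem exists_eval_ne_zero_of_no_tangent (hf : f.IsHomogeneous d) {a : Fin 3 → K} (ha : a ≠ 0)
    (hno : ∀ x ≠ 0, a ⬝ᵥ x = 0 → eval x f = 0 → ∀ c : K, gradAt f x ≠ c • a) :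
    ∃ v ≠ 0, a ⬝ᵥ v = 0 ∧ eval v f ≠ 0 := by
  by_contra! hall
  obtain ⟨v, hav, hv⟩ := exists_linearIndependent_pair_of_dotProduct_eq_zero (a := a) ha
  have hv0 : v ≠ 0 := hv.ne_zero 0
  obtain ⟨u, hau, huv⟩ := exists_linearIndependent_pair_of_dotProduct_eq_zero (a := a) hv0
  have hu0 : u ≠ 0 := huv.ne_zero 0
  have hzero : restrictLine f u v = 0 := Polynomial.funext fun t => by
    rw [eval_restrictLine, Polynomial.eval_zero]
    refine hall _ (fun hz => ?_) (by simp [dotProduct_add, hau, hav])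
    exact one_ne_zero ((LinearIndependent.pair_iff.1 huv) 1 t (by simpa using hz)).1
  obtain ⟨c, hc⟩ := eq_smul_of_dotProduct_pair_eq_zero (g := gradAt f u) huv ha hau hav
    (by rw [gradAt_dotProduct_self hf, hall u hu0 hau, mul_zero])
    (by rw [← coeff_one_restrictLine, hzero, Polynomial.coeff_zero])
  exact hno u hu0 hau (hall u hu0 hau) c hc

theorem ncard_curve_inter_line (hf : f.IsHomogeneous d) {a : Fin 3 → K} (ha : a ≠ 0)
    (hno : ∀ x ≠ 0, a ⬝ᵥ x = 0 → eval x f = 0 → ∀ c : K, gradAt f x ≠ c • a) :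
    {P : Projectivization K (Fin 3 → K) | eval P.rep f = 0 ∧ a ⬝ᵥ P.rep = 0}.ncard = d := by
  classical
  obtain ⟨v, hv0, hav, hfv⟩ := exists_eval_ne_zero_of_no_tangent hf ha hno
  obtain ⟨u, hau, huv⟩ := exists_linearIndependent_pair_of_dotProduct_eq_zero (a := a) hv0
  have hne : ∀ t : K, u + t • v ≠ 0 := fun t hz =>
    one_ne_zero ((LinearIndependent.pair_iff.1 huv) 1 t (by simpa using hz)).1
  have hline : ∀ t : K, a ⬝ᵥ (u + t • v) = 0 := fun t => by simp [dotProduct_add, hau, hav]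
  obtain ⟨h, hh⟩ : ∃ h, h = restrictLine f u v := ⟨_, rfl⟩
  have htop : h.coeff d ≠ 0 := by rwa [hh, coeff_top_restrictLine hf]
  have hh0 : h ≠ 0 := by
    rintro rfl
    exact htop (Polynomial.coeff_zero d)
  have hdeg : h.natDegree = d :=
    le_antisymm (hh ▸ natDegree_restrictLine_le hf u v) (Polynomial.le_natDegree_of_ne_zero htop)
  have heval : ∀ t, h.eval t = eval (u + t • v) f := fun t => by rw [hh, eval_restrictLine]
  have hnodup : h.roots.Nodup := by
    rw [Multiset.nodup_iff_count_le_one]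
    intro t
    rw [Polynomial.count_roots]
    by_contra! hlt
    obtain ⟨h1, h2⟩ := (Polynomial.one_lt_rootMultiplicity_iff_isRoot hh0).1 hlt
    rw [Polynomial.IsRoot, heval] at h1
    rw [Polynomial.IsRoot, hh, eval_derivative_restrictLine] at h2
    have h3 := gradAt_dotProduct_self hf (u + t • v)
    rw [h1, mul_zero, dotProduct_add, dotProduct_smul, h2, smul_zero, add_zero] at h3
    obtain ⟨c, hc⟩ := eq_smul_of_dotProduct_pair_eq_zero huv ha hau hav h3 h2
    exact hno _ (hne t) (hline t) h1 c hc
  have hcard : h.roots.toFinset.card = d := by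
    rw [Multiset.toFinset_card_of_nodup hnodup, ← (IsAlgClosed.splits h).natDegree_eq_card_roots,
      hdeg]
  have hset : {P : Projectivization K (Fin 3 → K) | eval P.rep f = 0 ∧ a ⬝ᵥ P.rep = 0} =
      (fun t => Projectivization.mk K (u + t • v) (hne t)) '' (h.roots.toFinset : Set K) := by
    ext P
    simp only [Set.mem_ofPred_eq, Set.mem_image, Finset.mem_coe, Multiset.mem_toFinset,
      Polynomial.mem_roots hh0, Polynomial.IsRoot, heval]
    constructor
    · rintro ⟨hfP, haP⟩
      obtain ⟨s, t, hst⟩ := exists_eq_add_of_dotProduct_eq_zero huv ha hau hav haP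
      have hs : s ≠ 0 := by
        rintro rfl
        rw [zero_smul, zero_add] at hst
        rw [hst, hf.eval_smul] at hfP
        have ht : t = 0 := eq_zero_of_pow_eq_zero ((mul_eq_zero.1 hfP).resolve_right hfv)
        exact P.rep_nonzero (by rw [hst, ht, zero_smul])
      have hPs : P.rep = s • (u + (t / s) • v) := by
        rw [hst, smul_add, smul_smul, mul_div_cancel₀ _ hs]
      refine ⟨t / s, ?_, ?_⟩
      · rw [hPs, hf.eval_smul] at hfP
        exact (mul_eq_zero.1 hfP).resolve_left (pow_ne_zero _ hs)
      · conv_rhs => rw [← P.mk_rep]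
        rw [Projectivization.mk_eq_mk_iff']
        exact ⟨s⁻¹, by rw [hPs, smul_smul, inv_mul_cancel₀ hs, one_smul]⟩
    · rintro ⟨t, ht, rfl⟩
      obtain ⟨c, hc⟩ := Projectivization.exists_smul_eq_mk_rep K (u + t • v) (hne t)
      rw [← hc, Units.smul_def, hf.eval_smul, ht, dotProduct_smul, hline]
      simp
  rw [hset, Set.InjOn.ncard_image, Set.ncard_coe_finset, hcard]
  intro t _ t' _ htt
  obtain ⟨c, hc⟩ := (Projectivization.mk_eq_mk_iff' _ _ _ _ _).1 htt
  have h0 : (c - 1) • u + (c * t' - t) • v = 0 := by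
    have hmod : (c - 1) • u + (c * t' - t) • v = c • (u + t' • v) - (u + t • v) := by module
    rw [hmod, hc, sub_self]
  obtain ⟨h1, h2⟩ := LinearIndependent.pair_iff.1 huv _ _ h0
  linear_combination t' * h1 - h2

end Lines

section Frobenius
variable {F K : Type*} [Field F] [Field K] [Algebra F K]

theorem eval_map_pow_card [Fintype F] {σ : Type*} (f : MvPolynomial σ F) (x : σ → K) :
    eval (fun i => x i ^ Fintype.card F) (map (algebraMap F K) f) =
      eval x (map (algebraMap F K) f) ^ Fintype.card F := by
  rw [eval_map, eval_map]
  exact (comp_aeval_apply x (FiniteField.frobeniusAlgHom F K) f).symm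

theorem gradAt_map_pow_card [Fintype F] {σ : Type*} (f : MvPolynomial σ F) (x : σ → K) :
    gradAt (map (algebraMap F K) f) (fun i => x i ^ Fintype.card F) =
      fun i => gradAt (map (algebraMap F K) f) x i ^ Fintype.card F := by
  ext i
  simp only [gradAt, pderiv_map, eval_map_pow_card]

theorem algebraMap_dotProduct_pow_card [Fintype F] {σ : Type*} [Fintype σ] (a : σ → F) (x : σ → K) :
    (algebraMap F K ∘ a) ⬝ᵥ (fun i => x i ^ Fintype.card F) =
      ((algebraMap F K ∘ a) ⬝ᵥ x) ^ Fintype.card F := by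
  have h := eval_map_pow_card (∑ i, C (a i) * X i) x
  simpa [dotProduct] using h

theorem exists_smul_of_algebraMap_eq_smul {σ : Type*} {a b : σ → F} (hb : b ≠ 0) {c : K}
    (h : algebraMap F K ∘ a = c • (algebraMap F K ∘ b)) : ∃ c₀ : F, a = c₀ • b := by
  obtain ⟨i, hi⟩ := Function.ne_iff.1 hb
  have hi' : algebraMap F K (b i) ≠ 0 := by simpa using hi
  have hc : c = algebraMap F K (a i / b i) := by
    have := congrFun h i
    simp only [Function.comp_apply, Pi.smul_apply, smul_eq_mul] at this
    rw [map_div₀, this, mul_div_cancel_right₀ _ hi']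
  refine ⟨a i / b i, funext fun j => (algebraMap F K).injective ?_⟩
  have := congrFun h j
  simpa [hc] using this

theorem linearIndependent_algebraMap_pair {σ : Type*} {a b : σ → F}
    (h : LinearIndependent F ![a, b]) :
    LinearIndependent K ![algebraMap F K ∘ a, algebraMap F K ∘ b] := by
  have hb : b ≠ 0 := h.ne_zero 1
  have hb' : algebraMap F K ∘ b ≠ 0 := by
    obtain ⟨i, hi⟩ := Function.ne_iff.1 hb
    exact Function.ne_iff.2 ⟨i, by simpa using hi⟩
  rw [LinearIndependent.pair_symm_iff, LinearIndependent.pair_iff' hb'] 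
  rw [LinearIndependent.pair_symm_iff, LinearIndependent.pair_iff' hb] at h
  intro c hc
  obtain ⟨c₀, hc₀⟩ := exists_smul_of_algebraMap_eq_smul hb hc.symm
  exact h c₀ hc₀.symm

theorem exists_algebraMap_comp_eq_smul {p : ℕ} [Fact p.Prime] [CharP K p] {σ : Type*}
    {x : σ → K} (hx : x ≠ 0) {c : K} (h : (fun i => x i ^ p) = c • x) :
    ∃ v : σ → F, ∃ r : K, r ≠ 0 ∧ algebraMap F K ∘ v = r • x := by
  obtain ⟨j, hj⟩ := Function.ne_iff.1 hx
  have hj : x j ≠ 0 := hj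
  have hmem : ∀ i, ∃ z : F, algebraMap F K z = x i / x j := by
    intro i
    have hbot : x i / x j ∈ (⊥ : Subfield K) := by
      rw [Subfield.mem_bot_iff_pow_eq_self K p, div_pow]
      have hi' : x i ^ p = c * x i := congrFun h i
      have hj' : x j ^ p = c * x j := congrFun h j
      have hc : c ≠ 0 := by
        rintro rfl
        exact pow_ne_zero p hj (by simpa using hj')
      rw [hi', hj', mul_div_mul_left _ _ hc]
    exact (bot_le : ⊥ ≤ (algebraMap F K).fieldRange) hbot
  choose v hv using hmem
  refine ⟨v, (x j)⁻¹, inv_ne_zero hj, funext fun i => ?_⟩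
  simp [hv, div_eq_inv_mul]

end Frobenius

section Tangent
variable {K : Type*} [Field K]

/-- The line with coefficient vector `a` is tangent to the curve defined by `f` at the point `x`,
which is a smooth point. -/
structure TangentAtVec (f : MvPolynomial (Fin 3) K) (a x : Fin 3 → K) : Prop where
  ne_zero : x ≠ 0
  eval_eq_zero : eval x f = 0
  dotProduct_eq_zero : a ⬝ᵥ x = 0
  gradAt_eq : ∃ c : K, c ≠ 0 ∧ gradAt f x = c • a

theorem TangentAtVec.smul {f : MvPolynomial (Fin 3) K} {d : ℕ} (hf : f.IsHomogeneous d)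
    {a x : Fin 3 → K} (h : TangentAtVec f a x) {r : K} (hr : r ≠ 0) :
    TangentAtVec f a (r • x) := by
  obtain ⟨c, hc, hcx⟩ := h.gradAt_eq
  refine ⟨smul_ne_zero hr h.ne_zero, ?_, ?_, r ^ (d - 1) * c, mul_ne_zero (pow_ne_zero _ hr) hc, ?_⟩
  · rw [hf.eval_smul, h.eval_eq_zero, mul_zero]
  · rw [dotProduct_smul, h.dotProduct_eq_zero, smul_zero]
  · rw [gradAt_smul hf, hcx, smul_smul]

theorem TangentAtVec.gradAt_dotProduct {f : MvPolynomial (Fin 3) K} {a x w : Fin 3 → K}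
    (h : TangentAtVec f a x) (hw : a ⬝ᵥ w = 0) : gradAt f x ⬝ᵥ w = 0 := by
  obtain ⟨c, -, hc⟩ := h.gradAt_eq
  rw [hc, smul_dotProduct, hw, smul_zero]

theorem TangentAtVec.linearIndependent {F : Type*} [Field F] [Algebra F K]
    {f : MvPolynomial (Fin 3) K} {d : ℕ} (hf : f.IsHomogeneous d) {a b : Fin 3 → F}
    {x y : Fin 3 → K} (hx : TangentAtVec f (algebraMap F K ∘ a) x)
    (hy : TangentAtVec f (algebraMap F K ∘ b) y) (ha : a ≠ 0) (hab : ∀ c : F, b ≠ c • a) :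
    LinearIndependent K ![x, y] := by
  rw [LinearIndependent.pair_iff' hx.ne_zero]
  rintro r rfl
  obtain ⟨c, hc, hcx⟩ := hx.gradAt_eq
  obtain ⟨e, he, hey⟩ := hy.gradAt_eq
  rw [gradAt_smul hf, hcx] at hey
  have h : algebraMap F K ∘ b = (e⁻¹ * (r ^ (d - 1) * c)) • (algebraMap F K ∘ a) := by
    rw [mul_smul, mul_smul, hey, smul_smul, inv_mul_cancel₀ he, one_smul]
  obtain ⟨c₀, hc₀⟩ := exists_smul_of_algebraMap_eq_smul ha h
  exact hab c₀ hc₀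

theorem TangentAtVec.pow_card {F : Type*} [Field F] [Fintype F] [Algebra F K]
    {f : MvPolynomial (Fin 3) F} {a : Fin 3 → F} {x : Fin 3 → K}
    (h : TangentAtVec (map (algebraMap F K) f) (algebraMap F K ∘ a) x) :
    TangentAtVec (map (algebraMap F K) f) (algebraMap F K ∘ a)
      (fun i => x i ^ Fintype.card F) := by
  obtain ⟨c, hc, hcx⟩ := h.gradAt_eq
  refine ⟨fun h0 => h.ne_zero ?_, ?_, ?_, c ^ Fintype.card F, pow_ne_zero _ hc, ?_⟩
  · exact funext fun i => eq_zero_of_pow_eq_zero (congrFun h0 i)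
  · rw [eval_map_pow_card, h.eval_eq_zero, zero_pow Fintype.card_ne_zero]
  · rw [algebraMap_dotProduct_pow_card, h.dotProduct_eq_zero, zero_pow Fintype.card_ne_zero]
  · rw [gradAt_map_pow_card, hcx]
    ext i
    simp [mul_pow, ← map_pow, FiniteField.pow_card]

end Tangent

section FrobeniusForm

theorem pderiv_comm {σ R : Type*} [CommRing R] (i j : σ) (f : MvPolynomial σ R) :
    pderiv i (pderiv j f) = pderiv j (pderiv i f) := by
  classical
  induction f using MvPolynomial.induction_on with
  | C a => simp
  | add f g hf hg => simp only [map_add, hf, hg]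
  | mul_X f k hf =>
    simp only [pderiv_mul, map_add, pderiv_X, Pi.single_apply, hf]
    split_ifs <;> simp; ring

variable {K : Type*} [Field K]

/-- The form `∑ ∂ᵢf · Xᵢ ^ q`, which vanishes at `x` when the `q`-th power Frobenius image of `x`
lies on the polar line of `f` at `x`. -/
def frobeniusForm (f : MvPolynomial (Fin 3) K) (q : ℕ) : MvPolynomial (Fin 3) K :=
  ∑ i, pderiv i f * X i ^ q

theorem isHomogeneous_frobeniusForm {f : MvPolynomial (Fin 3) K} {d : ℕ} (hf : f.IsHomogeneous d)
    (q : ℕ) : (frobeniusForm f q).IsHomogeneous (d - 1 + q) :=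
  IsHomogeneous.sum _ _ _ fun i _ => hf.pderiv.mul (isHomogeneous_X_pow i q)

theorem eval_frobeniusForm (f : MvPolynomial (Fin 3) K) (q : ℕ) (x : Fin 3 → K) :
    eval x (frobeniusForm f q) = gradAt f x ⬝ᵥ fun i => x i ^ q := by
  simp [frobeniusForm, dotProduct, gradAt]

theorem gradAt_frobeniusForm {f : MvPolynomial (Fin 3) K} {d : ℕ} (hf : f.IsHomogeneous d)
    (p : ℕ) [CharP K p] {x : Fin 3 → K} {c : K} (hx : (fun i => x i ^ p) = c • x) :
    gradAt (frobeniusForm f p) x = (c * (d - 1 : ℕ)) • gradAt f x := by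
  ext j
  have h1 : gradAt (frobeniusForm f p) x j = gradAt (pderiv j f) x ⬝ᵥ fun i => x i ^ p := by
    have hcomm : ∀ i, pderiv j (pderiv i f) = pderiv i (pderiv j f) := fun i =>
      pderiv_comm j i f
    simp [frobeniusForm, gradAt, dotProduct, mul_comm, hcomm]
  rw [h1, hx, dotProduct_smul, gradAt_dotProduct_self hf.pderiv]
  simp [gradAt, mul_assoc]

theorem eq_smul_or_linearIndependent {x y : Fin 3 → K} (hx : x ≠ 0) :
    (∃ c : K, y = c • x) ∨ LinearIndependent K ![x, y] := by
  rw [LinearIndependent.pair_iff' hx]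
  by_cases h : ∃ c : K, y = c • x
  · exact Or.inl h
  · exact Or.inr fun c hc => h ⟨c, hc.symm⟩

theorem TangentAtVec.eval_frobeniusForm {F : Type*} [Field F] [Fintype F] [Algebra F K]
    {f : MvPolynomial (Fin 3) K} {a : Fin 3 → F} {x : Fin 3 → K}
    (h : TangentAtVec f (algebraMap F K ∘ a) x) :
    eval x (frobeniusForm f (Fintype.card F)) = 0 := by
  rw [_root_.eval_frobeniusForm]
  apply h.gradAt_dotProduct
  rw [algebraMap_dotProduct_pow_card, h.dotProduct_eq_zero, zero_pow Fintype.card_ne_zero]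

theorem coeff_eq_zero_of_derivative_eq {p : ℕ} [Fact p.Prime] [CharP K p]
    {φ γ s : Polynomial K} (h0 : φ.coeff 0 = 0)
    (h : Polynomial.derivative φ = φ * γ - Polynomial.X ^ p * s) : ∀ k < p, φ.coeff k = 0 := by
  intro k
  induction k using Nat.strong_induction_on with
  | _ k ih =>
    intro hk
    rcases k with _ | k
    · exact h0
    have hc := congrArg (fun g => Polynomial.coeff g k) h
    simp only [Polynomial.coeff_derivative, Polynomial.coeff_sub, Polynomial.coeff_X_pow_mul',
      Polynomial.coeff_mul φ γ, if_neg (by omega : ¬ p ≤ k)] at hc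
    rw [Finset.sum_eq_zero, sub_zero, mul_eq_zero] at hc
    · refine hc.resolve_right fun hz => ?_
      have hz : ((k + 1 : ℕ) : K) = 0 := by exact_mod_cast hz
      rw [CharP.cast_eq_zero_iff K p] at hz
      exact absurd (Nat.le_of_dvd (by omega) hz) (by omega)
    · intro ij hij
      have := Finset.HasAntidiagonal.mem_antidiagonal.1 hij
      rw [ih ij.1 (by omega) (by omega), zero_mul]

theorem restrictLine_frobeniusForm {p : ℕ} [Fact p.Prime] [CharP K p]
    (f : MvPolynomial (Fin 3) K) (x : Fin 3 → K) :
    ∃ s : Polynomial K, restrictLine (frobeniusForm f p) x (fun i => x i ^ p) =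
      Polynomial.derivative (restrictLine f x fun i => x i ^ p) + Polynomial.X ^ p * s := by
  refine ⟨∑ i, restrictLine (pderiv i f) x (fun i => x i ^ p) * Polynomial.C ((x i ^ p) ^ p), ?_⟩
  rw [derivative_restrictLine, Finset.mul_sum, ← Finset.sum_add_distrib]
  simp only [restrictLine, frobeniusForm, map_sum, map_mul, map_pow, aeval_X]
  refine Finset.sum_congr rfl fun i _ => ?_
  rw [add_pow_char, mul_pow]
  ring

end FrobeniusForm

section Main
theorem rep_ne_smul_rep {F : Type*} [Field F] {P Q : Projectivization F (Fin 3 → F)} (h : P ≠ Q)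
    (c : F) : Q.rep ≠ c • P.rep := by
  intro hc
  apply h
  rw [← P.mk_rep, ← Q.mk_rep, eq_comm, Projectivization.mk_eq_mk_iff']
  exact ⟨c, hc.symm⟩

variable {F K : Type*} [Field F] [Fintype F] [Field K] [Algebra F K]
  {f : MvPolynomial (Fin 3) F} {d : ℕ}

theorem polynomial_eq_zero_of_forall_eval_algebraMap {h : Polynomial K}
    (hdeg : h.natDegree ≤ Fintype.card F) (h1 : h.coeff 1 = 0)
    (heval : ∀ t : F, h.eval (algebraMap F K t) = 0) : h = 0 := by
  have hq : 1 < Fintype.card F := Fintype.one_lt_card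
  obtain ⟨c, hc⟩ : ∃ c, c = h.coeff (Fintype.card F) := ⟨_, rfl⟩
  obtain ⟨g, hg⟩ : ∃ g, g = h - Polynomial.C c * (Polynomial.X ^ Fintype.card F - Polynomial.X) :=
    ⟨_, rfl⟩
  have hcoeff : ∀ k, Fintype.card F ≤ k → g.coeff k = 0 := by
    intro k hk
    rw [hg, Polynomial.coeff_sub, Polynomial.coeff_C_mul, Polynomial.coeff_sub,
      Polynomial.coeff_X_pow, Polynomial.coeff_X, if_neg (by omega : ¬ 1 = k)]
    rcases hk.eq_or_lt with rfl | hk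
    · simp [hc]
    · rw [if_neg hk.ne', Polynomial.coeff_eq_zero_of_natDegree_lt (hdeg.trans_lt hk)]
      simp
  have hgdeg : g.natDegree < Fintype.card F := by
    by_contra! hle
    have h0 : g = 0 := Polynomial.leadingCoeff_eq_zero.1 (hcoeff _ hle)
    rw [h0, Polynomial.natDegree_zero] at hle
    omega
  have hg0 : g = 0 := Polynomial.eq_zero_of_natDegree_lt_card_of_eval_eq_zero g
    (algebraMap F K).injective (fun t => by
      simp [hg, heval, ← map_pow, FiniteField.pow_card]) hgdeg
  have hh : h = Polynomial.C c * (Polynomial.X ^ Fintype.card F - Polynomial.X) :=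
    sub_eq_zero.1 (hg ▸ hg0)
  have hc0 : c = 0 := by
    rw [hh, Polynomial.coeff_C_mul, Polynomial.coeff_sub, Polynomial.coeff_X_pow,
      if_neg hq.ne, Polynomial.coeff_X_one] at h1
    simpa using h1
  rw [hh, hc0, Polynomial.C_0, zero_mul]

theorem eval_algebraMap_eq_zero_of_forall_tangent
    (hf : (map (algebraMap F K) f).IsHomogeneous d)
    (htan : ∀ a : Fin 3 → F, a ≠ 0 → ∃ v : Fin 3 → F,
      TangentAtVec (map (algebraMap F K) f) (algebraMap F K ∘ a) (algebraMap F K ∘ v))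
    {v : Fin 3 → F} (hv : v ≠ 0) : eval (algebraMap F K ∘ v) (map (algebraMap F K) f) = 0 := by
  choose u hu using fun P : Projectivization F (Fin 3 → F) => htan P.rep P.rep_nonzero
  have hu0 : ∀ P, u P ≠ 0 := by
    intro P h0
    apply (hu P).ne_zero
    ext
    simp [h0]
  let φ : Projectivization F (Fin 3 → F) → Projectivization F (Fin 3 → F) :=
    fun P => Projectivization.mk F (u P) (hu0 P)
  have hinj : Function.Injective φ := by
    intro P Q hPQ
    by_contra hne
    obtain ⟨c, hc⟩ := (Projectivization.mk_eq_mk_iff' _ _ _ _ _).1 hPQ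
    have hind := (hu Q).linearIndependent hf (hu P) Q.rep_nonzero
      (rep_ne_smul_rep (Ne.symm hne))
    rw [LinearIndependent.pair_iff' (hu Q).ne_zero] at hind
    refine hind (algebraMap F K c) ?_
    ext i
    simp [← hc]
  obtain ⟨P, hP⟩ := Finite.surjective_of_injective hinj (Projectivization.mk F v hv)
  obtain ⟨c, hc⟩ := (Projectivization.mk_eq_mk_iff' _ _ _ _ _).1 hP.symm
  have hcv : algebraMap F K ∘ v = algebraMap F K c • (algebraMap F K ∘ u P) := by
    ext i
    simp [← hc]
  rw [hcv, hf.eval_smul, (hu P).eval_eq_zero, mul_zero]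

variable [IsAlgClosed K] [CharP K (Fintype.card F)]

theorem dvd_frobeniusForm_of_forall_tangent (hf : (map (algebraMap F K) f).IsHomogeneous d)
    (hf0 : map (algebraMap F K) f ≠ 0) (hd : 0 < d) (hdq : d ≤ Fintype.card F + 1)
    (hsm : ∀ x ≠ 0, eval x (map (algebraMap F K) f) = 0 → gradAt (map (algebraMap F K) f) x ≠ 0)
    (htan : ∀ a : Fin 3 → F, a ≠ 0 →
      ∃ x, TangentAtVec (map (algebraMap F K) f) (algebraMap F K ∘ a) x) :
    map (algebraMap F K) f ∣ frobeniusForm (map (algebraMap F K) f) (Fintype.card F) := by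
  classical
  by_contra hndvd
  have hprime : Prime (map (algebraMap F K) f) :=
    (irreducible_of_gradAt_ne_zero hf hf0 hd hsm).prime
  have : Fintype (Projectivization F (Fin 3 → F)) := Fintype.ofFinite _
  choose x hx using fun P : Projectivization F (Fin 3 → F) => htan P.rep P.rep_nonzero
  choose w haw hw using fun P : Projectivization F (Fin 3 → F) =>
    exists_linearIndependent_pair_of_dotProduct_eq_zero (a := algebraMap F K ∘ P.rep)
      (hx P).ne_zero
  let y : Projectivization F (Fin 3 → F) → Fin 3 → K := fun P i => x P i ^ Fintype.card F
  have hy : ∀ P, TangentAtVec (map (algebraMap F K) f) (algebraMap F K ∘ P.rep) (y P) :=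
    fun P => (hx P).pow_card
  let ι := Projectivization F (Fin 3 → F) ⊕ {P // LinearIndependent K ![x P, y P]}
  let pt : ι → Projectivization F (Fin 3 → F) := Sum.elim id Subtype.val
  let z : ι → Fin 3 → K := Sum.elim x fun P => y P
  have hz : ∀ i, TangentAtVec (map (algebraMap F K) f) (algebraMap F K ∘ (pt i).rep) (z i) := by
    rintro (P | P)
    · exact hx P
    · exact hy P
  have hzz : ∀ i j, i ≠ j → LinearIndependent K ![z i, z j] := by
    intro i j hij
    by_cases hpt : pt i = pt j
    · rcases i with P | P <;> rcases j with Q | Q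
      · exact absurd (congrArg Sum.inl hpt) hij
      · obtain rfl : P = Q.1 := hpt
        exact Q.2
      · obtain rfl : P.1 = Q := hpt
        exact LinearIndependent.pair_symm_iff.1 P.2
      · exact absurd (congrArg Sum.inr (Subtype.ext hpt)) hij
    · exact (hz i).linearIndependent hf (hz j) (pt i).rep_nonzero (rep_ne_smul_rep hpt)
  let T : Finset ι :=
    (Finset.univ.filter fun P => ¬ LinearIndependent K ![x P, y P]).map Function.Embedding.inl
  have hT : ∀ i ∈ T, ∃ P, i = Sum.inl P ∧ ∃ c : K, y P = c • x P := by
    intro i hi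
    obtain ⟨P, hP, rfl⟩ := Finset.mem_map.1 hi
    exact ⟨P, rfl, (eq_smul_or_linearIndependent (hx P).ne_zero).resolve_right
      (Finset.mem_filter.1 hP).2⟩
  have hbez := card_add_card_le_mul hf (isHomogeneous_frobeniusForm hf (Fintype.card F)) hf0
    (fun h hdvd => (hprime.dvd_or_dvd hdvd).resolve_left hndvd)
    (x := z) (w := fun i => w (pt i)) T (fun i => (hz i).ne_zero) hzz
    (fun i hi => by
      obtain ⟨P, rfl, -⟩ := hT i hi
      exact hw P)
    (fun i => (hz i).eval_eq_zero) (fun i => (hz i).eval_frobeniusForm)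
    (fun i _ => (hz i).gradAt_dotProduct (haw _))
    (fun i hi => by
      obtain ⟨P, rfl, c, hc⟩ := hT i hi
      change gradAt _ (x P) ⬝ᵥ w P = 0
      rw [gradAt_frobeniusForm hf _ hc, smul_dotProduct, (hx P).gradAt_dotProduct (haw P),
        smul_zero])
  have hcard : Fintype.card ι + T.card = 2 * Fintype.card (Projectivization F (Fin 3 → F)) := by
    rw [Finset.card_map, Fintype.card_sum, Fintype.card_subtype, add_assoc,
      Finset.card_filter_add_card_filter_not, Finset.card_univ, two_mul]
  have hplane : Fintype.card (Projectivization F (Fin 3 → F)) =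
      1 + Fintype.card F + Fintype.card F ^ 2 := by
    rw [← Nat.card_eq_fintype_card, Projectivization.card_of_finrank F _ (n := 3) (by simp)]
    simp [Finset.sum_range_succ]
  rw [hcard, hplane] at hbez
  have hle : d * (d - 1 + Fintype.card F) ≤
      (Fintype.card F + 1) * (Fintype.card F + Fintype.card F) :=
    Nat.mul_le_mul hdq (by omega)
  nlinarith

variable [Fact (Fintype.card F).Prime]

theorem TangentAtVec.pow_card_eq_smul (hf : (map (algebraMap F K) f).IsHomogeneous d)
    (hd : 2 ≤ d) (hdq : d ≤ Fintype.card F + 1)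
    (hsm : ∀ x ≠ 0, eval x (map (algebraMap F K) f) = 0 → gradAt (map (algebraMap F K) f) x ≠ 0)
    (hdvd : map (algebraMap F K) f ∣ frobeniusForm (map (algebraMap F K) f) (Fintype.card F))
    {a : Fin 3 → F} {x : Fin 3 → K}
    (hx : TangentAtVec (map (algebraMap F K) f) (algebraMap F K ∘ a) x) :
    ∃ c : K, (fun i => x i ^ Fintype.card F) = c • x := by
  refine (eq_smul_or_linearIndependent hx.ne_zero).resolve_right fun hind => ?_
  refine restrictLine_ne_zero hf hd hsm hind ?_
  have hy := hx.pow_card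
  obtain ⟨g, hg⟩ := hdvd
  obtain ⟨s, hs⟩ := restrictLine_frobeniusForm (p := Fintype.card F) (map (algebraMap F K) f) x
  have hmul : restrictLine (map (algebraMap F K) f * g) x (fun i => x i ^ Fintype.card F) =
      restrictLine (map (algebraMap F K) f) x (fun i => x i ^ Fintype.card F) *
        restrictLine g x (fun i => x i ^ Fintype.card F) := by
    simp [restrictLine]
  have hlow := coeff_eq_zero_of_derivative_eq (p := Fintype.card F)
    (φ := restrictLine (map (algebraMap F K) f) x fun i => x i ^ Fintype.card F)
    (by rw [coeff_zero_restrictLine, hx.eval_eq_zero])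
    (eq_sub_of_add_eq (by rw [← hs, hg, hmul]))
  ext k
  rw [Polynomial.coeff_zero]
  rcases lt_or_ge k (Fintype.card F) with hk | hk
  · exact hlow k hk
  rcases lt_or_ge d k with hdk | hdk
  · exact Polynomial.coeff_eq_zero_of_natDegree_lt ((natDegree_restrictLine_le hf _ _).trans_lt hdk)
  rcases (by omega : k = d ∨ k = d - 1) with rfl | rfl
  · rw [coeff_top_restrictLine hf, hy.eval_eq_zero]
  · rw [coeff_pred_restrictLine hf (by omega), hy.gradAt_dotProduct hx.dotProduct_eq_zero]

theorem not_forall_exists_tangent (hf : (map (algebraMap F K) f).IsHomogeneous d)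
    (hf0 : map (algebraMap F K) f ≠ 0) (hd : 2 ≤ d) (hdq : d ≤ Fintype.card F + 1)
    (hsm : ∀ x ≠ 0, eval x (map (algebraMap F K) f) = 0 →
      gradAt (map (algebraMap F K) f) x ≠ 0) :
    ¬ ∀ a : Fin 3 → F, a ≠ 0 →
      ∃ x, TangentAtVec (map (algebraMap F K) f) (algebraMap F K ∘ a) x := by
  intro htan
  have hdvd := dvd_frobeniusForm_of_forall_tangent hf hf0 (by omega) hdq hsm htan
  have hrat : ∀ a : Fin 3 → F, a ≠ 0 → ∃ v : Fin 3 → F,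
      TangentAtVec (map (algebraMap F K) f) (algebraMap F K ∘ a) (algebraMap F K ∘ v) := by
    intro a ha
    obtain ⟨x, hx⟩ := htan a ha
    obtain ⟨c, hc⟩ := hx.pow_card_eq_smul hf hd hdq hsm hdvd
    obtain ⟨v, r, hr, hv⟩ := exists_algebraMap_comp_eq_smul (F := F) hx.ne_zero hc
    exact ⟨v, hv ▸ hx.smul hf hr⟩
  have hzero := fun {v} => eval_algebraMap_eq_zero_of_forall_tangent (v := v) hf hrat
  have ha : (Pi.single 0 1 : Fin 3 → F) ≠ 0 := by simp
  obtain ⟨v, hv⟩ := hrat _ ha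
  have hv0 : v ≠ 0 := by
    rintro rfl
    exact hv.ne_zero (by ext; simp)
  obtain ⟨w, haw, hwv⟩ := exists_linearIndependent_pair_of_dotProduct_eq_zero
    (a := (Pi.single 0 1 : Fin 3 → F)) hv0
  have hvw := LinearIndependent.pair_symm_iff.1 hwv
  have haw' : (algebraMap F K ∘ (Pi.single 0 1 : Fin 3 → F)) ⬝ᵥ (algebraMap F K ∘ w) = 0 := by
    rw [← (algebraMap F K).map_dotProduct, haw, map_zero]
  refine restrictLine_ne_zero hf hd hsm (linearIndependent_algebraMap_pair hvw)
    (polynomial_eq_zero_of_forall_eval_algebraMap (F := F) ?_ ?_ fun t => ?_)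
  · refine Polynomial.natDegree_le_iff_coeff_eq_zero.2 fun k hk => ?_
    rcases lt_or_ge d k with hdk | hdk
    · exact Polynomial.coeff_eq_zero_of_natDegree_lt
        ((natDegree_restrictLine_le hf _ _).trans_lt hdk)
    · obtain rfl : k = d := by omega
      rw [coeff_top_restrictLine hf]
      exact hzero (v := w) (hwv.ne_zero 0)
  · rw [coeff_one_restrictLine, hv.gradAt_dotProduct haw']
  · rw [eval_restrictLine]
    have hcomp : algebraMap F K ∘ v + algebraMap F K t • (algebraMap F K ∘ w) =
        algebraMap F K ∘ (v + t • w) := by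
      ext
      simp [Algebra.smul_def]
    rw [hcomp]
    refine hzero fun h0 => one_ne_zero ((LinearIndependent.pair_iff.1 hvw) 1 t ?_).1
    rwa [one_smul]

end Main

theorem gradAt_ne_zero_of_smoothCurve {F : Type*} [Field F] {f : MvPolynomial (Fin 3) F} {d : ℕ}
    (hf : f.IsHomogeneous d) (hsmooth : SmoothCurve f) (x : Fin 3 → AlgebraicClosure F)
    (hx : x ≠ 0) (hfx : eval x (map (algebraMap F (AlgebraicClosure F)) f) = 0) :
    gradAt (map (algebraMap F (AlgebraicClosure F)) f) x ≠ 0 := by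
  intro h0
  have hf' := hf.map (algebraMap F (AlgebraicClosure F))
  obtain ⟨c, hc⟩ := Projectivization.exists_smul_eq_mk_rep (AlgebraicClosure F) x hx
  rw [Units.smul_def] at hc
  obtain ⟨i, hi⟩ := hsmooth (Projectivization.mk _ x hx) (by
    rw [OnCurve, aeval_def, ← eval_map, ← hc, hf'.eval_smul, hfx, mul_zero])
  apply hi
  have h := congrFun (gradAt_smul hf' (c : AlgebraicClosure F) x) i
  rw [hc, h0, smul_zero, gradAt, pderiv_map, eval_map] at h
  exact h

theorem transverse_of_no_tangent {F : Type*} [Field F] {f : MvPolynomial (Fin 3) F} {d : ℕ}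
    (hf : f.IsHomogeneous d) {a : Fin 3 → F} (ha : a ≠ 0)
    (hno : ∀ x ≠ 0, (algebraMap F (AlgebraicClosure F) ∘ a) ⬝ᵥ x = 0 →
      eval x (map (algebraMap F (AlgebraicClosure F)) f) = 0 → ∀ c : AlgebraicClosure F,
        gradAt (map (algebraMap F (AlgebraicClosure F)) f) x ≠
          c • (algebraMap F (AlgebraicClosure F) ∘ a)) : Transverse f a d := by
  have ha' : algebraMap F (AlgebraicClosure F) ∘ a ≠ 0 := by
    obtain ⟨i, hi⟩ := Function.ne_iff.1 ha
    exact Function.ne_iff.2 ⟨i, by simpa using hi⟩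
  have h := ncard_curve_inter_line (hf.map (algebraMap F (AlgebraicClosure F))) ha' hno
  simp only [eval_map] at h
  exact h

/-- **Corollary (Bertini over the prime field).** If `C` is a smooth plane curve of degree
`d ≤ p + 1` over `F_p`, `p > 2` prime, then some `F_p`-line meets `C` transversely. -/
theorem bertini_prime_field
    (p d : ℕ) [Fact p.Prime] (hp : 2 < p)
    (F : Type*) [Field F] [Fintype F] (hcard : Fintype.card F = p)
    (f : MvPolynomial (Fin 3) F) (hf0 : f ≠ 0) (hfd : f.IsHomogeneous d)
    (hdp : d ≤ p + 1)
    (hsmooth : SmoothCurve f) :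
    ∃ a : Fin 3 → F, a ≠ 0 ∧ Transverse f a d := by
  by_contra! hno
  subst hcard
  have : CharP F (Fintype.card F) := charP_of_card_eq_prime rfl
  have : CharP (AlgebraicClosure F) (Fintype.card F) := charP_of_injective_algebraMap' F _
  have hf := hfd.map (algebraMap F (AlgebraicClosure F))
  have hf0' : map (algebraMap F (AlgebraicClosure F)) f ≠ 0 :=
    (map_ne_zero_iff _ (map_injective _ (algebraMap F (AlgebraicClosure F)).injective)).2 hf0
  have hsm := gradAt_ne_zero_of_smoothCurve hfd hsmooth
  have htan : ∀ a : Fin 3 → F, a ≠ 0 → ∃ x, TangentAtVec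
      (map (algebraMap F (AlgebraicClosure F)) f) (algebraMap F (AlgebraicClosure F) ∘ a) x := by
    intro a ha
    by_contra! hnone
    refine hno a ha (transverse_of_no_tangent hfd ha fun x hx hax hfx c hc => ?_)
    refine hnone x ⟨hx, hfx, hax, c, ?_, hc⟩
    rintro rfl
    exact hsm x hx hfx (by rw [hc, zero_smul])
  rcases Nat.lt_or_ge d 2 with hd | hd
  · have hconst : ∀ x, gradAt (map (algebraMap F (AlgebraicClosure F)) f) x =
        gradAt (map (algebraMap F (AlgebraicClosure F)) f) 0 := by
      intro x
      have h := gradAt_smul hf 0 x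
      rw [zero_smul, (by omega : d - 1 = 0), pow_zero, one_smul] at h
      exact h.symm
    obtain ⟨x, hx⟩ := htan (Pi.single 0 1) (by simp)
    obtain ⟨y, hy⟩ := htan (Pi.single 1 1) (by simp)
    obtain ⟨c, hc, hcx⟩ := hx.gradAt_eq
    obtain ⟨e, -, hey⟩ := hy.gradAt_eq
    rw [hconst, ← hconst y, hey] at hcx
    exact hc (by simpa using (congrFun hcx 0).symm)
  · exact not_forall_exists_tangent hf hf0' hd hdp hsm htan

end
end

section
/- Let C be a smooth plane curve of degree d over a finite field F_q of characteristic p > 2, and suppose q ≥ d(d - 1). Then there exists an F_q-line L such that L intersects C transversely, i.e., L ∩ C consists of d distinct points over the algebraic closure of F_q. -/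
open MvPolynomial

noncomputable section

variable {F : Type*} [Field F]

theorem isHomogeneous_resultant {σ R : Type*} [CommRing R] (A B : Polynomial (MvPolynomial σ R))
    (m n : ℕ) (hA : ∀ i j, i + j = m → (A.coeff i).IsHomogeneous j)
    (hB : ∀ i j, i + j = n → (B.coeff i).IsHomogeneous j) :
    (A.resultant B m n).IsHomogeneous (m * n) := by
  let c : Fin (m + n) → ℕ := Fin.addCases (fun j : Fin m => n + j) (fun j : Fin n => m + j)
  have hc : ∑ j, c j = m * n + ∑ i : Fin (m + n), (i : ℕ) := by
    simp only [Fin.sum_univ_add, c, Fin.addCases_left, Fin.addCases_right, Finset.sum_add_distrib,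
      Fin.val_castAdd, Fin.val_natAdd]
    simp
    ring
  have entry : ∀ i j, A.sylvester B m n i j = 0 ∨
      ∃ k, k + i = c j ∧ (A.sylvester B m n i j).IsHomogeneous k := by
    intro i j
    induction j using Fin.addCases with
    | left j =>
      simp only [Polynomial.sylvester, Matrix.of_apply, Fin.addCases_left, c, Set.mem_Icc]
      split_ifs with h
      · exact Or.inr ⟨n + j - i, by omega, hB _ _ (by omega)⟩
      · exact Or.inl rfl
    | right j =>
      simp only [Polynomial.sylvester, Matrix.of_apply, Fin.addCases_right, c, Set.mem_Icc]
      split_ifs with h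
      · exact Or.inr ⟨m + j - i, by omega, hA _ _ (by omega)⟩
      · exact Or.inl rfl
  rw [Polynomial.resultant, Matrix.det_apply]
  refine IsHomogeneous.sum _ _ _ fun τ _ => ?_
  rw [Units.smul_def, ← Int.cast_smul_eq_zsmul R, smul_eq_C_mul]
  refine IsHomogeneous.C_mul ?_ _
  by_cases h0 : ∃ j, A.sylvester B m n (τ j) j = 0
  · obtain ⟨j, hj⟩ := h0
    have hz : ∏ i, A.sylvester B m n (τ i) i = 0 := Finset.prod_eq_zero (Finset.mem_univ j) hj
    rw [hz]
    exact isHomogeneous_zero _ _ _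
  · push Not at h0
    choose k hk hkh using fun j => (entry (τ j) j).resolve_left (h0 j)
    have hsum : ∑ j, k j = m * n := by
      have h1 : ∑ j, (k j + (τ j : ℕ)) = ∑ j, c j := Finset.sum_congr rfl fun j _ => hk j
      rw [Finset.sum_add_distrib, Equiv.sum_comp τ (fun i : Fin (m + n) => (i : ℕ)), hc] at h1
      omega
    rw [← hsum]
    exact IsHomogeneous.prod _ _ _ fun j _ => hkh j

theorem natDegree_finSuccEquiv_le {R : Type*} [CommRing R] {N d : ℕ}
    {f : MvPolynomial (Fin (N + 1)) R} (hf : f.IsHomogeneous d) :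
    (finSuccEquiv R N f).natDegree ≤ d := by
  rw [natDegree_finSuccEquiv]
  exact (degreeOf_le_totalDegree f 0).trans hf.totalDegree_le

theorem coeff_finSuccEquiv_top {R : Type*} [CommRing R] {N d : ℕ}
    {f : MvPolynomial (Fin (N + 1)) R} (hf : f.IsHomogeneous d) :
    (finSuccEquiv R N f).coeff d = C (eval (Fin.cons 1 0) f) := by
  have hd := hf.finSuccEquiv_coeff_isHomogeneous d 0 (by simp)
  rw [eval_eq_eval_mv_eval', Polynomial.eval_eq_sum_range' (n := d + 1)
    (Nat.lt_succ_of_le (Polynomial.natDegree_map_le.trans (natDegree_finSuccEquiv_le hf))),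
    Finset.sum_range_succ, Finset.sum_eq_zero]
  · rw [Polynomial.coeff_map, totalDegree_eq_zero_iff_eq_C.mp
      ((totalDegree_zero_iff_isHomogeneous _).mpr hd)]
    simp
  · intro i hi
    have hi' := Finset.mem_range.mp hi
    have := (hf.finSuccEquiv_coeff_isHomogeneous i (d - i) (by omega)).coeff_eq_zero (d := 0)
      (by simp; omega)
    rw [Polynomial.coeff_map, one_pow, mul_one]
    rwa [← constantCoeff_eq, ← eval_zero] at this

theorem finSuccEquiv_pderiv_zero {R : Type*} [CommRing R] {N : ℕ}
    (f : MvPolynomial (Fin (N + 1)) R) :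
    finSuccEquiv R N (pderiv 0 f) = (finSuccEquiv R N f).derivative := by
  induction f using MvPolynomial.induction_on with
  | C a => simp [finSuccEquiv_apply]
  | add p q hp hq => simp [hp, hq]
  | mul_X p i h =>
    refine Fin.cases ?_ (fun j => ?_) i
    · simp [h, finSuccEquiv_X_zero]; ring
    · simp [h, finSuccEquiv_X_succ, pderiv_X]; ring

theorem aeval_finSuccEquiv {R S : Type*} [CommRing R] [CommRing S] [Algebra R S] {N : ℕ}
    (s : Fin N → S) (z : S) (f : MvPolynomial (Fin (N + 1)) R) :
    aeval (Fin.cons z s : Fin (N + 1) → S) f =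
      Polynomial.eval z ((finSuccEquiv R N f).map (aeval s : MvPolynomial (Fin N) R →ₐ[R] S).toRingHom) := by
  induction f using MvPolynomial.induction_on with
  | C a => simp [finSuccEquiv_apply]
  | add p q hp hq => simp [hp, hq]
  | mul_X p i h =>
    refine Fin.cases ?_ (fun j => ?_) i
    · simp [h, finSuccEquiv_X_zero]
    · simp [h, finSuccEquiv_X_succ]

theorem exists_homogeneous_factors {σ R : Type*} [CommRing R] [IsDomain R]
    {f g h : MvPolynomial σ R} {d : ℕ} (hf : f.IsHomogeneous d) (hf0 : f ≠ 0) (hfgh : f = g * h) :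
    f = homogeneousComponent g.totalDegree g * homogeneousComponent h.totalDegree h ∧
      g.totalDegree + h.totalDegree = d := by
  have hg0 : g ≠ 0 := by rintro rfl; simp_all
  have hh0 : h ≠ 0 := by rintro rfl; simp_all
  have hd : g.totalDegree + h.totalDegree = d := by
    rw [← totalDegree_mul_of_isDomain hg0 hh0, ← hfgh, hf.totalDegree hf0]
  refine ⟨?_, hd⟩
  have hcomp : ∀ i j, homogeneousComponent d (homogeneousComponent i g * homogeneousComponent j h) =
      if d = i + j then homogeneousComponent i g * homogeneousComponent j h else 0 := fun i j =>
    homogeneousComponent_of_mem ((homogeneousComponent_isHomogeneous i g).mul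
      (homogeneousComponent_isHomogeneous j h))
  calc f = homogeneousComponent d f := (homogeneousComponent_eq_self hf).symm
    _ = homogeneousComponent d ((∑ i ∈ Finset.range (g.totalDegree + 1), homogeneousComponent i g) *
        ∑ j ∈ Finset.range (h.totalDegree + 1), homogeneousComponent j h) := by
      rw [sum_homogeneousComponent, sum_homogeneousComponent, ← hfgh]
    _ = _ := by
      rw [Finset.sum_mul_sum, map_sum, Finset.sum_eq_single_of_mem g.totalDegree (by simp)]
      · rw [map_sum, Finset.sum_eq_single_of_mem h.totalDegree (by simp)]
        · rw [hcomp, if_pos hd.symm]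
        · intro j hj hne
          rw [hcomp, if_neg (by omega)]
      · intro i hi hne
        rw [map_sum]
        refine Finset.sum_eq_zero fun j hj => ?_
        have := Finset.mem_range.mp hi
        have := Finset.mem_range.mp hj
        rw [hcomp, if_neg (by omega)]

theorem aeval_linear_homogeneous {σ τ R : Type*} [CommRing R] [Fintype τ]
    (M : Matrix σ τ R) {f : MvPolynomial σ R} {d : ℕ} (hf : f.IsHomogeneous d) :
    (aeval (fun i => ∑ j, C (M i j) * X j : σ → MvPolynomial τ R) f).IsHomogeneous d := by
  rw [← one_mul d]
  exact hf.aeval _ fun i => IsHomogeneous.sum _ _ _ fun j _ => isHomogeneous_C_mul_X _ _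

theorem pderiv_aeval_linear {σ τ R : Type*} [CommRing R] [Fintype σ] [Fintype τ]
    (M : Matrix σ τ R) (f : MvPolynomial σ R) (j : τ) :
    pderiv j (aeval (fun i => ∑ j, C (M i j) * X j : σ → MvPolynomial τ R) f) =
      ∑ i, C (M i j) * aeval (fun i => ∑ j, C (M i j) * X j : σ → MvPolynomial τ R) (pderiv i f) := by
  classical
  induction f using MvPolynomial.induction_on with
  | C a => simp
  | add p q hp hq => simp only [map_add, hp, hq, mul_add, Finset.sum_add_distrib]
  | mul_X p k h =>
    simp only [map_mul, aeval_X, Derivation.leibniz, smul_eq_mul, h, pderiv_X, map_add, mul_add,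
      Finset.sum_add_distrib, map_sum, pderiv_C]
    congr 1
    · simp [Pi.single_apply, mul_comm]
    · rw [Finset.mul_sum]
      exact Finset.sum_congr rfl fun i _ => by ring

theorem aeval_smul_homogeneous {σ R S : Type*} [CommRing R] [CommRing S] [Algebra R S]
    {f : MvPolynomial σ R} {d : ℕ} (hf : f.IsHomogeneous d) (c : S) (x : σ → S) :
    aeval (c • x) f = c ^ d * aeval x f := by
  rw [aeval_def, aeval_def, eval₂_eq, eval₂_eq, Finset.mul_sum]
  refine Finset.sum_congr rfl fun m hm => ?_
  simp only [Pi.smul_apply, smul_eq_mul, mul_pow, Finset.prod_mul_distrib]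
  rw [Finset.prod_pow_eq_pow_sum, ← hf.degree_eq_sum_deg_support hm]
  ring

theorem exists_aeval_eq_zero_of_isHomogeneous {F K : Type*} [Field F] [Field K] [Algebra F K]
    [IsAlgClosed K] {D : MvPolynomial (Fin 2) F} {e : ℕ} (he : 0 < e) (hD : D.IsHomogeneous e) :
    ∃ s : Fin 2 → K, s ≠ 0 ∧ aeval s D = 0 := by
  by_cases h : eval (Fin.cons 1 0 : Fin 2 → F) D = 0
  · refine ⟨algebraMap F K ∘ (Fin.cons 1 0 : Fin 2 → F), fun h0 => ?_, ?_⟩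
    · simpa using congrFun h0 0
    · rw [aeval_algebraMap_apply, aeval_eq_eval]
      simp [h]
  · set p : Polynomial K := (finSuccEquiv F 1 D).map
      (aeval (1 : Fin 1 → K) : MvPolynomial (Fin 1) F →ₐ[F] K).toRingHom with hp
    have hpe : p.coeff e ≠ 0 := by
      rw [hp, Polynomial.coeff_map, coeff_finSuccEquiv_top hD]
      simpa using h
    have hdeg : p.degree ≠ 0 := fun h0 =>
      absurd (Polynomial.le_natDegree_of_ne_zero hpe)
        (by rw [Polynomial.natDegree_eq_zero_iff_degree_le_zero.mpr h0.le]; omega)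
    obtain ⟨z, hz⟩ := IsAlgClosed.exists_root p hdeg
    refine ⟨Fin.cons z 1, fun h0 => ?_, ?_⟩
    · simpa using congrFun h0 1
    · rw [aeval_finSuccEquiv]
      exact hz

theorem exists_common_zero_s3 {F K : Type*} [Field F] [Field K] [Algebra F K]
    [IsAlgClosed K] {g h : MvPolynomial (Fin 3) F} {m n : ℕ} (hm : 0 < m) (hn : 0 < n)
    (hg : g.IsHomogeneous m) (hh : h.IsHomogeneous n)
    (hg1 : eval (Fin.cons 1 0) g ≠ 0) (hh1 : eval (Fin.cons 1 0) h ≠ 0) :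
    ∃ x : Fin 3 → K, x ≠ 0 ∧ aeval x g = 0 ∧ aeval x h = 0 := by
  obtain ⟨s, hs, hs0⟩ := exists_aeval_eq_zero_of_isHomogeneous (K := K) (Nat.mul_pos hm hn)
    (isHomogeneous_resultant (finSuccEquiv F 2 g) (finSuccEquiv F 2 h) m n
      (hg.finSuccEquiv_coeff_isHomogeneous) (hh.finSuccEquiv_coeff_isHomogeneous))
  set φ := (aeval s : MvPolynomial (Fin 2) F →ₐ[F] K).toRingHom with hφ
  have key : ∀ {k : MvPolynomial (Fin 3) F} {l : ℕ}, k.IsHomogeneous l →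
      eval (Fin.cons 1 0) k ≠ 0 → ((finSuccEquiv F 2 k).map φ).natDegree = l := by
    intro k l hk hk1
    refine le_antisymm (Polynomial.natDegree_map_le.trans (natDegree_finSuccEquiv_le hk))
      (Polynomial.le_natDegree_of_ne_zero ?_)
    rw [Polynomial.coeff_map, coeff_finSuccEquiv_top hk]
    simpa [hφ] using hk1
  have hres : Polynomial.resultant ((finSuccEquiv F 2 g).map φ) ((finSuccEquiv F 2 h).map φ) = 0 := by
    rw [key hg hg1, key hh hh1, Polynomial.resultant_map_map]
    exact hs0
  obtain ⟨-, hnc⟩ := Polynomial.resultant_eq_zero_iff.mp hres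
  rw [Polynomial.isCoprime_iff_aeval_ne_zero_of_isAlgClosed K K] at hnc
  push Not at hnc
  obtain ⟨z, hz1, hz2⟩ := hnc
  refine ⟨Fin.cons z s, fun h0 => hs ?_, ?_, ?_⟩
  · funext i
    simpa using congrFun h0 i.succ
  · rw [aeval_finSuccEquiv, ← hφ]; simpa using hz1
  · rw [aeval_finSuccEquiv, ← hφ]; simpa using hz2

theorem irreducible_of_smooth {F K : Type*} [Field F] [Field K] [Algebra F K]
    [IsAlgClosed K] {f : MvPolynomial (Fin 3) F} {d : ℕ} (hd : 0 < d)
    (hf : f.IsHomogeneous d) (hf1 : eval (Fin.cons 1 0) f ≠ 0)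
    (hs : ∀ x : Fin 3 → K, x ≠ 0 → aeval x f = 0 → ∃ i, aeval x (pderiv i f) ≠ 0) :
    Irreducible f := by
  have hf0 : f ≠ 0 := by rintro rfl; simp at hf1
  refine ⟨fun hu => ?_, fun g h hgh => ?_⟩
  · have := hf.totalDegree hf0
    have := (isUnit_iff_totalDegree_of_isReduced.mp hu).2
    omega
  · by_contra! hcon
    obtain ⟨hfac, hdeg⟩ := exists_homogeneous_factors hf hf0 hgh
    have pos : ∀ k : MvPolynomial (Fin 3) F, k ≠ 0 → ¬ IsUnit k → 0 < k.totalDegree := by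
      intro k hk hku
      by_contra! hk0
      refine hku (isUnit_iff_totalDegree_of_isReduced.mpr ⟨?_, by omega⟩)
      rw [totalDegree_eq_zero_iff_eq_C.mp (Nat.le_zero.mp hk0)] at hk
      simpa using hk
    have hg0 : g ≠ 0 := by rintro rfl; simp_all
    have hh0 : h ≠ 0 := by rintro rfl; simp_all
    have hne := hf1
    rw [hfac, map_mul, mul_ne_zero_iff] at hne
    obtain ⟨x, hx0, hxg, hxh⟩ := exists_common_zero_s3 (K := K) (pos g hg0 hcon.1) (pos h hh0 hcon.2)
      (homogeneousComponent_isHomogeneous _ g) (homogeneousComponent_isHomogeneous _ h) hne.1 hne.2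
    obtain ⟨i, hi⟩ := hs x hx0 (by rw [hfac, map_mul, hxg, zero_mul])
    apply hi
    rw [hfac, pderiv_mul, map_add, map_mul, map_mul, hxg, hxh]
    simp

theorem exists_separable_pencil_member {F K : Type*} [Field F] [Finite F] [Field K] [Algebra F K]
    [IsAlgClosed K] {f : MvPolynomial (Fin 3) F} {d : ℕ} (hd : 0 < d)
    (hf : f.IsHomogeneous d) (hf1 : eval (Fin.cons 1 0) f ≠ 0) (hf' : pderiv 0 f ≠ 0)
    (hs : ∀ x : Fin 3 → K, x ≠ 0 → aeval x f = 0 → ∃ i, aeval x (pderiv i f) ≠ 0)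
    (hq : d * (d - 1) ≤ Nat.card F) :
    ∃ s : Fin 2 → F, s ≠ 0 ∧ ((finSuccEquiv F 2 f).map (eval s)).Separable := by
  set A := finSuccEquiv F 2 f with hA
  have hAd : A.natDegree ≤ d := natDegree_finSuccEquiv_le hf
  have hAc : A.coeff d = C (eval (Fin.cons 1 0) f) := coeff_finSuccEquiv_top hf
  have hAdeg : A.natDegree = d := le_antisymm hAd (Polynomial.le_natDegree_of_ne_zero
    (by rw [hAc]; simpa using hf1))
  have hA' : A.derivative = finSuccEquiv F 2 (pderiv 0 f) := (finSuccEquiv_pderiv_zero f).symm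
  have hA'd : A.derivative.natDegree ≤ d - 1 := by
    rw [hA']; exact natDegree_finSuccEquiv_le hf.pderiv
  set D := A.resultant A.derivative d (d - 1) with hD
  have hDhom : D.IsHomogeneous (d * (d - 1)) := by
    refine isHomogeneous_resultant _ _ _ _ hf.finSuccEquiv_coeff_isHomogeneous ?_
    rw [hA']
    exact hf.pderiv.finSuccEquiv_coeff_isHomogeneous
  have hirr : Irreducible A :=
    (MulEquiv.irreducible_iff (finSuccEquiv F 2)).mpr (irreducible_of_smooth hd hf hf1 hs)
  have hprim : A.IsPrimitive := fun r hr =>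
    isUnit_of_dvd_unit ((Polynomial.C_dvd_iff_dvd_coeff r A).mp hr d)
      (by rw [hAc]; simpa using hf1)
  let L := FractionRing (MvPolynomial (Fin 2) F)
  let ι := algebraMap (MvPolynomial (Fin 2) F) L
  have hι : Function.Injective ι := IsFractionRing.injective _ _
  have hD0 : D ≠ 0 := by
    have hirrL : Irreducible (A.map ι) :=
      (hprim.irreducible_iff_irreducible_map_fraction_map (K := L)).mp hirr
    have hcop : IsCoprime (A.map ι) (A.derivative.map ι) := by
      refine (hirrL.coprime_iff_not_dvd).mpr fun hdvd => ?_
      have hle := Polynomial.natDegree_le_of_dvd hdvd (by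
        rw [Ne, Polynomial.map_eq_zero_iff hι, hA']
        simpa using hf')
      rw [Polynomial.natDegree_map_eq_of_injective hι,
        Polynomial.natDegree_map_eq_of_injective hι] at hle
      omega
    have hres := Polynomial.resultant_ne_zero _ _ hcop
    rw [Polynomial.natDegree_map_eq_of_injective hι,
        Polynomial.natDegree_map_eq_of_injective hι, Polynomial.resultant_map_map, hAdeg] at hres
    obtain ⟨k, hk⟩ := Nat.exists_eq_add_of_le hA'd
    rw [hD, hk, Polynomial.resultant_add_right_deg _ _ _ _ _ le_rfl, hAc]
    refine mul_ne_zero (pow_ne_zero _ (by simpa using hf1)) fun h0 => hres ?_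
    rw [h0, map_zero]
  obtain ⟨s, hs0, hDs⟩ : ∃ s : Fin 2 → F, s ≠ 0 ∧ eval s D ≠ 0 := by
    by_contra! hcon
    refine hD0 ?_
    have hcard : ((d * (d - 1) : ℕ) : Cardinal) ≤ Cardinal.mk F := by
      rw [← Nat.cast_card]; exact_mod_cast hq
    refine hDhom.eq_zero_of_forall_eval_eq_zero_of_le_card (fun r => ?_) hcard
    by_cases hr : r = 0
    · rcases Nat.eq_zero_or_pos (d * (d - 1)) with h0 | h0
      · rw [h0, ← totalDegree_zero_iff_isHomogeneous, totalDegree_eq_zero_iff_eq_C] at hDhom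
        have := hcon 1 one_ne_zero
        rw [hDhom] at this ⊢
        simpa using this
      · rw [hr, eval_zero, constantCoeff_eq]
        exact hDhom.coeff_eq_zero (by rw [map_zero]; exact h0.ne)
    · exact hcon r hr
  refine ⟨s, hs0, ?_⟩
  rw [Polynomial.separable_def, Polynomial.derivative_map]
  obtain ⟨p, q, -, -, hpq⟩ := Polynomial.exists_mul_add_mul_eq_C_resultant A A.derivative hAd hA'd
    (Or.inl hd.ne')
  have hpq' := congrArg (Polynomial.map (eval s)) hpq
  simp only [Polynomial.map_add, Polynomial.map_mul, Polynomial.map_C] at hpq'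
  refine ⟨Polynomial.C (eval s D)⁻¹ * p.map (eval s), Polynomial.C (eval s D)⁻¹ * q.map (eval s), ?_⟩
  calc _ = Polynomial.C (eval s D)⁻¹ * (A.map (eval s) * p.map (eval s) +
        A.derivative.map (eval s) * q.map (eval s)) := by ring
    _ = 1 := by rw [hpq', ← Polynomial.C_mul, inv_mul_cancel₀ hDs, Polynomial.C_1]

theorem exists_invertible_matrix_col_zero_eq {F : Type*} [Field F] {v : Fin 3 → F} (hv : v ≠ 0) :
    ∃ M N : Matrix (Fin 3) (Fin 3) F, M * N = 1 ∧ N * M = 1 ∧ ∀ i, M i 0 = v i := by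
  obtain ⟨k, hk⟩ := Function.ne_iff.mp hv
  let M₀ : Matrix (Fin 3) (Fin 3) F := (1 : Matrix (Fin 3) (Fin 3) F).updateCol k v
  let M : Matrix (Fin 3) (Fin 3) F := M₀.submatrix id (Equiv.swap 0 k)
  have h₀ : M₀.det = v k := by
    have := Matrix.cramer_apply (1 : Matrix (Fin 3) (Fin 3) F) v k
    rw [Matrix.cramer_one] at this
    exact this.symm
  have hM : IsUnit M.det := by
    rw [Matrix.det_permute', h₀]
    exact ((Units.isUnit _).map (Int.castRingHom F)).mul (isUnit_iff_ne_zero.mpr hk)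
  exact ⟨M, M⁻¹, Matrix.mul_nonsing_inv _ hM, Matrix.nonsing_inv_mul _ hM, fun i => by simp [M, M₀]⟩

theorem exists_eval_ne_zero_and_directional_pderiv_ne_zero {F : Type*} [Field F] [Finite F]
    {f : MvPolynomial (Fin 3) F} {d : ℕ} (hf : f.IsHomogeneous d) (hf0 : f ≠ 0)
    {i : Fin 3} (hi : pderiv i f ≠ 0) (hq : d + 1 ≤ Nat.card F) :
    ∃ v : Fin 3 → F, eval v f ≠ 0 ∧ ∑ j, C (v j) * pderiv j f ≠ 0 := by
  obtain ⟨m, hm⟩ := ne_zero_iff.mp hi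
  let l : MvPolynomial (Fin 3) F := ∑ j, C (coeff m (pderiv j f)) * X j
  have hl : l.IsHomogeneous 1 := IsHomogeneous.sum _ _ _ fun j _ => isHomogeneous_C_mul_X _ _
  have hl0 : l ≠ 0 := fun h => hm (by
    have := congrArg (eval (Pi.single i 1)) h
    simpa [l, Pi.single_apply] using this)
  have hcard : ((d + 1 : ℕ) : Cardinal) ≤ Cardinal.mk F := by
    rw [← Nat.cast_card]; exact_mod_cast hq
  by_contra! hcon
  refine mul_ne_zero hf0 hl0
    ((hf.mul hl).eq_zero_of_forall_eval_eq_zero_of_le_card (fun v => ?_) hcard)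
  by_cases hv : eval v f = 0
  · rw [map_mul, hv, zero_mul]
  · have := congrArg (coeff m) (hcon v hv)
    rw [map_mul]
    refine mul_eq_zero_of_right _ ?_
    simpa [l, coeff_sum, coeff_C_mul, mul_comm] using this

theorem exists_ne_zero_aeval_eq_zero {F K : Type*} [Field F] [Field K] [Algebra F K]
    [IsAlgClosed K] {f : MvPolynomial (Fin 3) F} {d : ℕ} (hd : 0 < d) (hf : f.IsHomogeneous d) :
    ∃ x : Fin 3 → K, x ≠ 0 ∧ aeval x f = 0 := by
  have hD : (aeval (![X 0, X 1, 0] : Fin 3 → MvPolynomial (Fin 2) F) f).IsHomogeneous d := by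
    rw [← one_mul d]
    refine hf.aeval _ fun i => ?_
    fin_cases i
    · exact isHomogeneous_X _ _
    · exact isHomogeneous_X _ _
    · exact isHomogeneous_zero _ _ _
  obtain ⟨s, hs, hs0⟩ := exists_aeval_eq_zero_of_isHomogeneous (K := K) hd hD
  refine ⟨fun i => aeval s ((![X 0, X 1, 0] : Fin 3 → MvPolynomial (Fin 2) F) i), fun h => hs ?_, ?_⟩
  · funext i
    fin_cases i
    · simpa using congrFun h 0
    · simpa using congrFun h 1
  · rw [← hs0, ← AlgHom.comp_apply, comp_aeval]

theorem aeval_aeval_linear {σ τ R S : Type*} [CommRing R] [CommRing S] [Algebra R S] [Fintype τ]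
    (M : Matrix σ τ R) (f : MvPolynomial σ R) (x : τ → S) :
    aeval x (aeval (fun i => ∑ j, C (M i j) * X j : σ → MvPolynomial τ R) f) =
      aeval ((M.map (algebraMap R S)).mulVec x) f := by
  rw [← AlgHom.comp_apply, comp_aeval]
  congr 2
  funext i
  simp [Matrix.mulVec, dotProduct]

theorem SmoothCurve.exists_aeval_pderiv_ne_zero {F : Type*} [Field F]
    {f : MvPolynomial (Fin 3) F} {d : ℕ} (hf : f.IsHomogeneous d) (hs : SmoothCurve f)
    (x : Fin 3 → AlgebraicClosure F) (hx : x ≠ 0) (hxf : aeval x f = 0) :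
    ∃ i, aeval x (pderiv i f) ≠ 0 := by
  obtain ⟨c, hc⟩ := Projectivization.exists_smul_eq_mk_rep (AlgebraicClosure F) x hx
  have hc' : (c : AlgebraicClosure F) • x = (Projectivization.mk _ x hx).rep := hc
  obtain ⟨i, hi⟩ := hs (Projectivization.mk _ x hx) (by
    rw [OnCurve, ← hc', aeval_smul_homogeneous hf, hxf, mul_zero])
  rw [← hc', aeval_smul_homogeneous hf.pderiv] at hi
  exact ⟨i, right_ne_zero_of_mul hi⟩

theorem smooth_aeval_linear {F K : Type*} [Field F] [Field K] [Algebra F K]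
    {f : MvPolynomial (Fin 3) F} {M N : Matrix (Fin 3) (Fin 3) F} (hMN : M * N = 1)
    (hNM : N * M = 1)
    (hs : ∀ x : Fin 3 → K, x ≠ 0 → aeval x f = 0 → ∃ i, aeval x (pderiv i f) ≠ 0)
    (x : Fin 3 → K) (hx : x ≠ 0)
    (hxf : aeval x (aeval (fun i => ∑ j, C (M i j) * X j : Fin 3 → MvPolynomial (Fin 3) F) f) = 0) :
    ∃ j, aeval x (pderiv j
      (aeval (fun i => ∑ j, C (M i j) * X j : Fin 3 → MvPolynomial (Fin 3) F) f)) ≠ 0 := by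
  set MK := M.map (algebraMap F K) with hMK
  have hMNK : MK * N.map (algebraMap F K) = 1 := by
    rw [hMK, ← Matrix.map_mul, hMN, Matrix.map_one _ (map_zero _) (map_one _)]
  have hNMK : N.map (algebraMap F K) * MK = 1 := by
    rw [hMK, ← Matrix.map_mul, hNM, Matrix.map_one _ (map_zero _) (map_one _)]
  rw [aeval_aeval_linear, ← hMK] at hxf
  obtain ⟨i, hi⟩ := hs (MK.mulVec x) (fun h0 => hx (by
    rw [← Matrix.one_mulVec x, ← hNMK, ← Matrix.mulVec_mulVec, h0, Matrix.mulVec_zero])) hxf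
  by_contra! hcon
  let g : Fin 3 → K := fun i => aeval (MK.mulVec x) (pderiv i f)
  have hg : Matrix.vecMul g MK = 0 := by
    funext j
    have := hcon j
    rw [pderiv_aeval_linear, map_sum] at this
    simp only [map_mul, aeval_aeval_linear, aeval_C] at this
    simpa [Matrix.vecMul, dotProduct, g, hMK, mul_comm] using this
  have hg0 : g = 0 := by
    rw [← Matrix.vecMul_one g, ← hMNK, ← Matrix.vecMul_vecMul, hg, Matrix.zero_vecMul]
  exact hi (congrFun hg0 i)

theorem transverse_of_separable {F : Type*} [Field F] {f : MvPolynomial (Fin 3) F} {d : ℕ}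
    (hf : f.IsHomogeneous d) {M N : Matrix (Fin 3) (Fin 3) F} (hMN : M * N = 1) (hNM : N * M = 1)
    {g : MvPolynomial (Fin 3) F}
    (hg : g = aeval (fun i => ∑ j, C (M i j) * X j : Fin 3 → MvPolynomial (Fin 3) F) f)
    (hg1 : eval (Fin.cons 1 0) g ≠ 0) {s : Fin 2 → F} (hs : s ≠ 0)
    (hsep : ((finSuccEquiv F 2 g).map (eval s)).Separable) :
    Transverse f (Matrix.vecMul ![0, s 1, -s 0] N) d := by
  set K := AlgebraicClosure F
  set MK := M.map (algebraMap F K) with hMK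
  set NK := N.map (algebraMap F K) with hNK
  have hMNK : MK * NK = 1 := by
    rw [hMK, hNK, ← Matrix.map_mul, hMN, Matrix.map_one _ (map_zero _) (map_one _)]
  have hNMK : NK * MK = 1 := by
    rw [hMK, hNK, ← Matrix.map_mul, hNM, Matrix.map_one _ (map_zero _) (map_one _)]
  have hgd : g.IsHomogeneous d := hg ▸ aeval_linear_homogeneous M hf
  have hgf : ∀ x : Fin 3 → K, aeval x g = aeval (MK.mulVec x) f := fun x => by
    rw [hg, aeval_aeval_linear]
  let t : Fin 2 → K := fun i => algebraMap F K (s i)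
  have ht : t ≠ 0 := fun h => hs (funext fun i => by simpa [t] using congrFun h i)
  set p := (finSuccEquiv F 2 g).map (eval s) with hp
  have hpd : p.natDegree = d := by
    refine le_antisymm (Polynomial.natDegree_map_le.trans (natDegree_finSuccEquiv_le hgd))
      (Polynomial.le_natDegree_of_ne_zero ?_)
    rw [hp, Polynomial.coeff_map, coeff_finSuccEquiv_top hgd]
    simpa using hg1
  have hp0 : p ≠ 0 := hsep.ne_zero
  have hroot : ∀ z : K, Polynomial.aeval z p = aeval (MK.mulVec (Fin.cons z t)) f := by
    intro z
    rw [← hgf, aeval_finSuccEquiv, hp, Polynomial.aeval_def, ← Polynomial.eval_map,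
      Polynomial.map_map]
    congr 2
    refine MvPolynomial.ringHom_ext (fun r => ?_) (fun i => ?_)
    · simp
    · simp [t]
  let x : K → Fin 3 → K := fun z => MK.mulVec (Fin.cons z t)
  have hx_inv : ∀ z, NK.mulVec (x z) = Fin.cons z t := fun z => by
    simp only [x]
    rw [Matrix.mulVec_mulVec, hNMK, Matrix.one_mulVec]
  have hx0 : ∀ z, x z ≠ 0 := fun z h => ht (by
    have h1 := hx_inv z
    rw [h, Matrix.mulVec_zero] at h1
    funext i
    simpa using (congrFun h1 i.succ).symm)
  have hline : ∀ y : Fin 3 → K,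
      ∑ i, algebraMap F K (Matrix.vecMul ![0, s 1, -s 0] N i) * y i =
        t 1 * NK.mulVec y 1 - t 0 * NK.mulVec y 2 := by
    intro y
    simp [Matrix.vecMul, Matrix.mulVec, dotProduct, Fin.sum_univ_three, hNK, t]
    ring
  have hset : {P : ProjPlane K | OnCurve f P ∧ OnLine (Matrix.vecMul ![0, s 1, -s 0] N) P} =
      (fun z => Projectivization.mk K (x z) (hx0 z)) '' p.rootSet K := by
    ext P
    constructor
    · rintro ⟨hPC, hPL⟩
      set y := NK.mulVec P.rep with hy
      have hMy : MK.mulVec y = P.rep := by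
        rw [hy, Matrix.mulVec_mulVec, hMNK, Matrix.one_mulVec]
      have hrel : t 1 * y 1 - t 0 * y 2 = 0 := by rw [← hline P.rep]; exact hPL
      obtain ⟨c, hc⟩ : ∃ c : K, ∀ i : Fin 2, y i.succ = c * t i := by
        by_cases h0 : t 0 = 0
        · have h1 : t 1 ≠ 0 := fun h1 => ht (by funext i; fin_cases i <;> assumption)
          refine ⟨y 2 / t 1, fun i => ?_⟩
          fin_cases i
          · have : y 1 = 0 := by simpa [h0, h1] using hrel
            simp [h0, this]
          · exact (div_mul_cancel₀ _ h1).symm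
        · refine ⟨y 1 / t 0, fun i => ?_⟩
          fin_cases i
          · exact (div_mul_cancel₀ _ h0).symm
          · change y 2 = y 1 / t 0 * t 1
            rw [div_mul_eq_mul_div, eq_div_iff h0]
            linear_combination -hrel
      have hyg : aeval y g = 0 := by rw [hgf, hMy]; exact hPC
      have hc0 : c ≠ 0 := by
        rintro rfl
        have hyv : y = y 0 • (algebraMap F K ∘ (Fin.cons 1 0 : Fin 3 → F)) := by
          funext i
          refine Fin.cases ?_ (fun j => ?_) i
          · simp
          · simp [hc j]
        rw [hyv, aeval_smul_homogeneous hgd, aeval_algebraMap_apply, aeval_eq_eval] at hyg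
        have hy0 : y 0 = 0 := by
          rcases mul_eq_zero.mp hyg with h | h
          · by_contra hne
            exact pow_ne_zero _ hne h
          · exact absurd (by simpa using h) hg1
        rw [hy0, zero_smul] at hyv
        rw [hyv, Matrix.mulVec_zero] at hMy
        exact P.rep_nonzero hMy.symm
      have hyc : y = c • (Fin.cons (y 0 / c) t : Fin 3 → K) := by
        funext i
        refine Fin.cases ?_ (fun j => ?_) i
        · simp [hc0, mul_div_cancel₀]
        · simp [hc j]
      have hrep : P.rep = c • x (y 0 / c) := by
        rw [← hMy]
        conv_lhs => rw [hyc]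
        rw [Matrix.mulVec_smul]
      refine ⟨y 0 / c, ?_, ?_⟩
      · rw [Polynomial.mem_rootSet]
        refine ⟨hp0, ?_⟩
        have h1 : aeval P.rep f = 0 := hPC
        rw [hrep, aeval_smul_homogeneous hf] at h1
        rw [hroot]
        exact (mul_eq_zero.mp h1).resolve_left (pow_ne_zero _ hc0)
      · rw [← P.mk_rep, Projectivization.mk_eq_mk_iff']
        refine ⟨c⁻¹, ?_⟩
        rw [hrep, smul_smul, inv_mul_cancel₀ hc0, one_smul]
    · rintro ⟨z, hz, rfl⟩
      obtain ⟨c, hc⟩ := Projectivization.exists_smul_eq_mk_rep K (x z) (hx0 z)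
      have hc' : (c : K) • x z = (Projectivization.mk K (x z) (hx0 z)).rep := hc
      refine ⟨?_, ?_⟩
      · rw [OnCurve]
        dsimp only
        rw [← hc', aeval_smul_homogeneous hf]
        rw [Polynomial.mem_rootSet, hroot] at hz
        rw [hz.2, mul_zero]
      · rw [OnLine]
        dsimp only
        rw [hline, ← hc', Matrix.mulVec_smul, hx_inv]
        have h1 : (Fin.cons z t : Fin 3 → K) 1 = t 0 := rfl
        have h2 : (Fin.cons z t : Fin 3 → K) 2 = t 1 := rfl
        rw [Pi.smul_apply, Pi.smul_apply, h1, h2, smul_eq_mul, smul_eq_mul]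
        ring
  have hinj : Function.Injective fun z => Projectivization.mk K (x z) (hx0 z) := by
    intro z w hzw
    obtain ⟨c, hc⟩ := (Projectivization.mk_eq_mk_iff' _ _ _ _ _).mp hzw
    have h1 := congrArg NK.mulVec hc
    rw [Matrix.mulVec_smul, hx_inv, hx_inv] at h1
    obtain ⟨i, hi⟩ := Function.ne_iff.mp ht
    have hc1 : c = 1 := by
      have := congrFun h1 i.succ
      simp only [Pi.smul_apply, Fin.cons_succ, smul_eq_mul] at this
      exact mul_right_cancel₀ hi (by rw [this, one_mul])
    have := congrFun h1 0
    simpa [hc1] using this.symm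
  rw [Transverse, hset, Set.ncard_image_of_injective _ hinj, Set.ncard_eq_toFinset_card',
    Set.toFinset_card, Polynomial.card_rootSet_eq_natDegree hsep (IsAlgClosed.splits _), hpd]

/-- **Bertini with the quadratic bound.** If `C` is a smooth plane curve of degree `d`
over `F_q` of characteristic `p > 2` with `q ≥ d(d-1)`, then some `F_q`-line meets `C`
transversely. -/
theorem bertini_quadratic_bound
    (p q d : ℕ) [Fact p.Prime] (hp : 2 < p)
    (F : Type*) [Field F] [Fintype F] [CharP F p] (hcard : Fintype.card F = q)
    (f : MvPolynomial (Fin 3) F) (hf0 : f ≠ 0) (hfd : f.IsHomogeneous d)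
    (hdq : d * (d - 1) ≤ q)
    (hsmooth : SmoothCurve f) :
    ∃ a : Fin 3 → F, a ≠ 0 ∧ Transverse f a d := by
  classical
  subst hcard
  rw [Fintype.card_eq_nat_card] at hdq
  rcases Nat.eq_zero_or_pos d with rfl | hd
  · refine ⟨1, one_ne_zero, ?_⟩
    rw [← totalDegree_zero_iff_isHomogeneous, totalDegree_eq_zero_iff_eq_C] at hfd
    have hempty : {P : ProjPlane (AlgebraicClosure F) | OnCurve f P ∧ OnLine (1 : Fin 3 → F) P} = ∅ := by
      refine Set.eq_empty_of_forall_notMem fun P hP => ?_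
      have h0 : aeval P.rep f = 0 := hP.1
      rw [hfd, aeval_C] at h0
      refine hf0 ?_
      rw [hfd, (map_eq_zero _).mp h0, C_0]
    rw [Transverse, hempty, Set.ncard_empty]
  have hs := SmoothCurve.exists_aeval_pderiv_ne_zero hfd hsmooth
  have hq3 : 3 ≤ Nat.card F := by
    have hdvd : p ∣ Nat.card F := (CharP.cast_eq_zero_iff F p _).mp (by
      rw [← Fintype.card_eq_nat_card]
      exact FiniteField.cast_card_eq_zero F)
    have hle := Nat.le_of_dvd Nat.card_pos hdvd
    omega
  have hq : d + 1 ≤ Nat.card F := by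
    rcases Nat.lt_or_ge d 3 with h | h
    · omega
    · have : d * 2 ≤ d * (d - 1) := Nat.mul_le_mul_left _ (by omega)
      omega
  obtain ⟨x, hx0, hx⟩ := exists_ne_zero_aeval_eq_zero (K := AlgebraicClosure F) hd hfd
  obtain ⟨i, hi⟩ := hs x hx0 hx
  have hi0 : pderiv i f ≠ 0 := fun h => hi (by rw [h, map_zero])
  obtain ⟨v, hv, hvd⟩ := exists_eval_ne_zero_and_directional_pderiv_ne_zero hfd hf0 hi0 hq
  have hv0 : v ≠ 0 := by
    rintro rfl
    simp at hvd
  obtain ⟨M, N, hMN, hNM, hM⟩ := exists_invertible_matrix_col_zero_eq hv0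
  set φ : MvPolynomial (Fin 3) F →ₐ[F] MvPolynomial (Fin 3) F :=
    aeval (fun i => ∑ j, C (M i j) * X j) with hφ
  have hcol : M.mulVec (Fin.cons 1 0) = v := by
    funext i
    simp [Matrix.mulVec, dotProduct, Fin.sum_univ_succ, hM]
  have hg1 : eval (Fin.cons 1 0) (φ f) ≠ 0 := by
    rw [← aeval_eq_eval]
    change aeval (Fin.cons 1 0 : Fin 3 → F) (φ f) ≠ 0
    rw [hφ, aeval_aeval_linear]
    simpa [hcol, aeval_eq_eval] using hv
  have hg' : pderiv 0 (φ f) ≠ 0 := by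
    have hcomp : ∀ h, aeval (fun i => ∑ j, C (N i j) * X j : Fin 3 → MvPolynomial (Fin 3) F) (φ h) = h := by
      intro h
      rw [hφ, aeval_aeval_linear]
      have hN : (fun i => ∑ j, C (N i j) * X j : Fin 3 → MvPolynomial (Fin 3) F) =
          (N.map (algebraMap F (MvPolynomial (Fin 3) F))).mulVec X := rfl
      rw [hN, Matrix.mulVec_mulVec, ← Matrix.map_mul, hMN,
        Matrix.map_one _ (map_zero _) (map_one _), Matrix.one_mulVec, aeval_X_left_apply]
    rw [hφ, pderiv_aeval_linear, ← hφ]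
    intro h0
    apply hvd
    have := congrArg (aeval (fun i => ∑ j, C (N i j) * X j : Fin 3 → MvPolynomial (Fin 3) F)) h0
    simpa only [map_sum, map_mul, map_zero, hcomp, algHom_C, algebraMap_eq, hM] using this
  obtain ⟨s, hs0, hsep⟩ := exists_separable_pencil_member (K := AlgebraicClosure F) hd
    (aeval_linear_homogeneous M hfd) hg1 hg' (smooth_aeval_linear hMN hNM hs) hdq
  refine ⟨Matrix.vecMul ![0, s 1, -s 0] N, fun h => hs0 ?_,
    transverse_of_separable hfd hMN hNM rfl hg1 hs0 hsep⟩
  have hb : (![0, s 1, -s 0] : Fin 3 → F) = 0 := by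
    rw [← Matrix.vecMul_one ![0, s 1, -s 0], ← hNM, ← Matrix.vecMul_vecMul, h, Matrix.zero_vecMul]
  funext i
  fin_cases i
  · simpa using congrFun hb 2
  · simpa using congrFun hb 1

end
end

section
/- Let p > 2 be a prime and q = p^r. The plane curve C over F_q defined by x·y^p + y·z^p + z·x^p = 0 is a smooth curve of degree p + 1, and there exists an F_q-line L that intersects C transversely, i.e., L ∩ C consists of p + 1 distinct points over the algebraic closure of F_q. -/
open MvPolynomial

noncomputable section

variable {F : Type*} [Field F]

/-- The Artin–Schreier equation `tᵖ - t = 1` has exactly `p` solutions in an algebraically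
closed field of characteristic `p`. -/
theorem ncard_artinSchreier_solutions (K : Type*) [Field K] [IsAlgClosed K] (p : ℕ)
    [Fact p.Prime] [CharP K p] : {t : K | t ^ p - t = 1}.ncard = p := by
  classical
  have hp1 : 1 < p := (Fact.out : p.Prime).one_lt
  have hlt : (Polynomial.X + Polynomial.C 1 : Polynomial K).degree < (p : ℕ) := by
    rw [Polynomial.degree_X_add_C]
    exact_mod_cast hp1
  set g : Polynomial K := Polynomial.X ^ p - (Polynomial.X + Polynomial.C 1) with hg
  have hdeg : g.natDegree = p := Polynomial.natDegree_eq_of_degree_eq_some <| by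
    rw [hg, Polynomial.degree_sub_eq_left_of_degree_lt] <;> rw [Polynomial.degree_X_pow]
    exact hlt
  have hg0 : g ≠ 0 := by
    rintro h
    rw [h, Polynomial.natDegree_zero] at hdeg
    omega
  have hsep : g.Separable := by
    rw [Polynomial.separable_def]
    have : Polynomial.derivative g = -1 := by
      simp [hg, Polynomial.derivative_X_pow]
    rw [this]
    exact isCoprime_one_right.neg_right
  have hset : {t : K | t ^ p - t = 1} = g.rootSet K := by
    ext t
    rw [Polynomial.mem_rootSet_of_ne hg0]
    simp [hg, ← sub_sub, sub_eq_zero]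
  rw [hset, ← Nat.card_coe_set_eq, Nat.card_eq_fintype_card,
    Polynomial.card_rootSet_eq_natDegree hsep (IsAlgClosed.splits _), hdeg]

/-- The line `x + y = 0` meets the curve `x·yᵖ + y·zᵖ + z·xᵖ = 0` exactly in the point
`[0 : 0 : 1]` and the points `[-1 : 1 : t]` with `tᵖ - t = 1`. -/
theorem pardini_inter_line_iff {K : Type*} [Field K] {p : ℕ} (hp : Odd p) (P : ProjPlane K) :
    (P.rep 0 * P.rep 1 ^ p + P.rep 1 * P.rep 2 ^ p + P.rep 2 * P.rep 0 ^ p = 0 ∧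
        P.rep 0 + P.rep 1 = 0) ↔
      P = Projectivization.mk K ![0, 0, 1] (by simp) ∨
      ∃ t : K, t ^ p - t = 1 ∧ Projectivization.mk K ![-1, 1, t] (by simp) = P := by
  have hp0 : p ≠ 0 := hp.pos.ne'
  constructor
  · rintro ⟨hc, hl⟩
    have hx : P.rep 0 = -P.rep 1 := eq_neg_of_add_eq_zero_left hl
    by_cases hy : P.rep 1 = 0
    · left
      rw [← P.mk_rep, Projectivization.mk_eq_mk_iff']
      refine ⟨P.rep 2, ?_⟩
      funext i
      fin_cases i <;> simp [hx, hy]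
    · right
      refine ⟨P.rep 2 / P.rep 1, ?_, ?_⟩
      · rw [hx, hp.neg_pow] at hc
        have hc' : P.rep 2 ^ p - P.rep 2 / P.rep 1 * P.rep 1 ^ p = P.rep 1 ^ p := by
          apply mul_left_cancel₀ hy
          field_simp
          linear_combination hc
        have hyp : P.rep 1 ^ p ≠ 0 := pow_ne_zero _ hy
        apply mul_right_cancel₀ hyp
        rw [sub_mul, ← mul_pow, div_mul_cancel₀ _ hy, hc', one_mul]
      · conv_rhs => rw [← P.mk_rep]
        rw [Projectivization.mk_eq_mk_iff']
        refine ⟨(P.rep 1)⁻¹, ?_⟩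
        funext i
        fin_cases i <;> simp [hx, hy, div_eq_inv_mul]
  · rintro (rfl | ⟨t, ht, rfl⟩)
    · obtain ⟨a, ha⟩ := Projectivization.exists_smul_eq_mk_rep K ![(0 : K), 0, 1] (by simp)
      rw [← ha]
      simp [Units.smul_def, hp0]
    · obtain ⟨a, ha⟩ := Projectivization.exists_smul_eq_mk_rep K ![-1, 1, t] (by simp)
      rw [← ha]
      simp only [Units.smul_def, Pi.smul_apply, Matrix.cons_val, smul_eq_mul, mul_pow,
        hp.neg_pow, one_pow]
      constructor
      · linear_combination (a : K) * (a : K) ^ p * ht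
      · ring

/-- The line `x + y = 0` meets the curve `x·yᵖ + y·zᵖ + z·xᵖ = 0` in `p + 1` points. -/
theorem ncard_pardini_inter_line (K : Type*) [Field K] [IsAlgClosed K] {p : ℕ}
    [Fact p.Prime] [CharP K p] (hp : Odd p) :
    {P : ProjPlane K |
      P.rep 0 * P.rep 1 ^ p + P.rep 1 * P.rep 2 ^ p + P.rep 2 * P.rep 0 ^ p = 0 ∧
        P.rep 0 + P.rep 1 = 0}.ncard = p + 1 := by
  let φ : K → ProjPlane K := fun t => Projectivization.mk K ![-1, 1, t] (by simp)
  have hφ : Function.Injective φ := by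
    intro s t h
    obtain ⟨c, hc⟩ := (Projectivization.mk_eq_mk_iff' _ _ _ _ _).1 h
    have h1 : c = 1 := by simpa using congrFun hc 1
    simpa [h1, eq_comm] using congrFun hc 2
  have hcard := ncard_artinSchreier_solutions K p
  have hfin : {t : K | t ^ p - t = 1}.Finite :=
    Set.finite_of_ncard_ne_zero (hcard.trans_ne (Fact.out : p.Prime).ne_zero)
  have hset : {P : ProjPlane K |
      P.rep 0 * P.rep 1 ^ p + P.rep 1 * P.rep 2 ^ p + P.rep 2 * P.rep 0 ^ p = 0 ∧
        P.rep 0 + P.rep 1 = 0} =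
      insert (Projectivization.mk K ![0, 0, 1] (by simp)) (φ '' {t : K | t ^ p - t = 1}) := by
    ext P
    exact pardini_inter_line_iff hp P
  rw [hset, Set.ncard_insert_of_notMem _ (hfin.image φ), Set.ncard_image_of_injective _ hφ, hcard]
  rintro ⟨t, -, h⟩
  obtain ⟨c, hc⟩ := (Projectivization.mk_eq_mk_iff' _ _ _ _ _).1 h
  simpa using congrFun hc 1

/-- The curve `x·yᵖ + y·zᵖ + z·xᵖ = 0` (Pardini's non-reflexive curve of degree `p + 1`)
is smooth of degree `p + 1` over any finite field of characteristic `p > 2`, and it admits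
an `F_q`-line meeting it transversely. -/
theorem pardini_curve_has_transverse_line
    (p r q : ℕ) [Fact p.Prime] (hp : 2 < p) (hr : 1 ≤ r) (hq : q = p ^ r)
    (F : Type*) [Field F] [Fintype F] [CharP F p] (hcard : Fintype.card F = q) :
    (X 0 * X 1 ^ p + X 1 * X 2 ^ p + X 2 * X 0 ^ p : MvPolynomial (Fin 3) F).IsHomogeneous
      (p + 1) ∧
    SmoothCurve (X 0 * X 1 ^ p + X 1 * X 2 ^ p + X 2 * X 0 ^ p : MvPolynomial (Fin 3) F) ∧
    ∃ a : Fin 3 → F, a ≠ 0 ∧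
      Transverse (X 0 * X 1 ^ p + X 1 * X 2 ^ p + X 2 * X 0 ^ p : MvPolynomial (Fin 3) F)
        a (p + 1) := by
  refine ⟨?_, ?_, ![1, 1, 0], by simp, ?_⟩
  · have h (i j : Fin 3) : (X i * X j ^ p : MvPolynomial (Fin 3) F).IsHomogeneous (p + 1) := by
      simpa [add_comm] using (isHomogeneous_X F i).mul (isHomogeneous_X_pow (R := F) j p)
    exact ((h 0 1).add (h 1 2)).add (h 2 0)
  · intro P _
    by_contra! h
    have hp0 : p ≠ 0 := by omega
    apply P.rep_nonzero
    funext i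
    have h0 := h 0
    have h1 := h 1
    have h2 := h 2
    simp [Derivation.leibniz, Derivation.leibniz_pow, pderiv_X, hp0] at h0 h1 h2
    fin_cases i <;> assumption
  · have : CharP (AlgebraicClosure F) p :=
      charP_of_injective_algebraMap (algebraMap F (AlgebraicClosure F)).injective p
    have hodd : Odd p := (Fact.out : p.Prime).odd_of_ne_two hp.ne'
    rw [← ncard_pardini_inter_line (AlgebraicClosure F) hodd]
    simp [Transverse, OnCurve, OnLine, Fin.sum_univ_three]

end
end

section
/- Let C be a smooth Frobenius non-classical plane curve of degree d over F_q (characteristic p > 2). Then there exists an F_q-line intersecting C transversely if and only if there exists an F_q-line L containing d distinct F_q-rational points of C. -/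
open MvPolynomial

noncomputable section

variable {F : Type*} [Field F]

section LinePoly

variable {f : MvPolynomial (Fin 3) F} {d : ℕ}
  {v w : Fin 3 → AlgebraicClosure F}

lemma aeval_smul_of_isHomogeneous (hf : f.IsHomogeneous d) (c : AlgebraicClosure F)
    (v : Fin 3 → AlgebraicClosure F) : aeval (c • v) f = c ^ d * aeval v f := by
  rw [aeval_def, aeval_def, eval₂_eq, eval₂_eq, Finset.mul_sum]
  refine Finset.sum_congr rfl fun m hm => ?_
  have hdeg : ∑ i ∈ m.support, m i = d := (hf.degree_eq_sum_deg_support hm).symm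
  simp only [Pi.smul_apply, smul_eq_mul, mul_pow, Finset.prod_mul_distrib,
    Finset.prod_pow_eq_pow_sum, hdeg]
  ring

lemma eval_linePoly (f : MvPolynomial (Fin 3) F) (v w : Fin 3 → AlgebraicClosure F)
    (t : AlgebraicClosure F) : (LinePoly f v w).eval t = aeval (v + t • w) f := by
  have h := MvPolynomial.comp_aeval_apply
    (fun i => Polynomial.C (v i) + Polynomial.X * Polynomial.C (w i))
    ((Polynomial.aeval t : Polynomial (AlgebraicClosure F) →ₐ[AlgebraicClosure F] _).restrictScalars
      F) f
  rw [AlgHom.restrictScalars_apply, Polynomial.coe_aeval_eq_eval] at h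
  rw [LinePoly, h]
  congr 2
  ext i
  simp [Polynomial.X_mul_C, mul_comm t]

lemma natDegree_linePoly_le (hf : f.IsHomogeneous d) (v w : Fin 3 → AlgebraicClosure F) :
    (LinePoly f v w).natDegree ≤ d := by
  have h := aeval_natDegree_le (m := d) (n := 1) (map (algebraMap F (AlgebraicClosure F)) f)
    (hf.map _).totalDegree_le (fun i => Polynomial.C (v i) + Polynomial.X * Polynomial.C (w i))
    (fun i => by compute_degree)
  rwa [mul_one, aeval_map_algebraMap] at h

lemma derivative_linePoly (f : MvPolynomial (Fin 3) F) (v w : Fin 3 → AlgebraicClosure F) :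
    (LinePoly f v w).derivative = ∑ i, LinePoly (pderiv i f) v w * Polynomial.C (w i) := by
  unfold LinePoly
  induction f using MvPolynomial.induction_on with
  | C c =>
    simp [IsScalarTower.algebraMap_apply F (AlgebraicClosure F)
      (Polynomial (AlgebraicClosure F))]
  | add g h hg hh => simp only [map_add, hg, hh, add_mul, Finset.sum_add_distrib]
  | mul_X g j hg =>
    simp only [map_mul, aeval_X, Polynomial.derivative_mul, hg, Derivation.leibniz, smul_eq_mul,
      map_add, pderiv_X, add_mul, Finset.sum_add_distrib]
    fin_cases j <;> simp [Fin.sum_univ_three] <;> ring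

lemma eval_zero_derivative_linePoly (f : MvPolynomial (Fin 3) F)
    (v w : Fin 3 → AlgebraicClosure F) :
    (LinePoly f v w).derivative.eval 0 = ∑ i, aeval v (pderiv i f) * w i := by
  simp [derivative_linePoly, Polynomial.eval_finsetSum, eval_linePoly]

lemma sum_aeval_pderiv_mul_self (hf : f.IsHomogeneous d) (hv : aeval v f = 0) :
    ∑ i, aeval v (pderiv i f) * v i = 0 := by
  have h := congrArg (aeval v) hf.sum_X_mul_pderiv
  simpa [hv, mul_comm] using h

/-- A point off the curve on the line through `v` and `w` makes the restriction nonzero. -/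
lemma linePoly_ne_zero (hf : f.IsHomogeneous d) (hw : aeval w f ≠ 0) : LinePoly f v w ≠ 0 := by
  intro h0
  have hk : LinePoly f w v * Polynomial.X = 0 := by
    refine Polynomial.funext fun s => ?_
    rcases eq_or_ne s 0 with rfl | hs
    · simp
    · have h : w + s • v = s • (v + s⁻¹ • w) := by
        rw [smul_add, smul_smul, mul_inv_cancel₀ hs, one_smul, add_comm]
      rw [Polynomial.eval_mul, eval_linePoly, h, aeval_smul_of_isHomogeneous hf, ← eval_linePoly,
        h0]
      simp
  have := congrArg (Polynomial.eval 0)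
    ((mul_eq_zero.mp hk).resolve_right Polynomial.X_ne_zero)
  exact hw (by simpa [eval_linePoly] using this)

end LinePoly

section Lines

variable {K : Type*} [Field K] {a u v w : Fin 3 → K}

/-- Three vectors in `K^3` orthogonal to a common nonzero vector are linearly dependent. -/
lemma exists_linear_combination_eq_zero (ha : a ≠ 0) (hu : ∑ i, a i * u i = 0)
    (hv : ∑ i, a i * v i = 0) (hw : ∑ i, a i * w i = 0) :
    ∃ r s t : K, (r ≠ 0 ∨ s ≠ 0 ∨ t ≠ 0) ∧ r • u + s • v + t • w = 0 := by
  have hdet : (Matrix.of ![u, v, w]).det = 0 := by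
    refine Matrix.exists_mulVec_eq_zero_iff.mp ⟨a, ha, ?_⟩
    ext j
    fin_cases j <;> simpa [Matrix.mulVec, dotProduct, mul_comm]
  obtain ⟨c, hc, h⟩ := Matrix.exists_vecMul_eq_zero_iff.mpr hdet
  refine ⟨c 0, c 1, c 2, ?_, ?_⟩
  · by_contra! h'
    exact hc (funext fun i => by fin_cases i <;> simp [h'])
  · ext j
    have := congrFun h j
    simpa [Matrix.vecMul, dotProduct, Fin.sum_univ_three] using this

/-- A line in the projective plane is spanned by any two of its points. -/
lemma exists_eq_smul_add_smul (ha : a ≠ 0) (hu : ∑ i, a i * u i = 0)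
    (hv : ∑ i, a i * v i = 0) (hw : ∑ i, a i * w i = 0) (hu0 : u ≠ 0)
    (huv : ∀ c : K, v ≠ c • u) : ∃ r s : K, w = r • u + s • v := by
  obtain ⟨r, s, t, h, h0⟩ := exists_linear_combination_eq_zero ha hu hv hw
  rcases eq_or_ne t 0 with rfl | ht
  · exfalso
    rcases eq_or_ne s 0 with rfl | hs
    · simp_all
    · refine huv (-(s⁻¹ * r)) ?_
      have : s • v = -(r • u) := by
        rw [zero_smul, add_zero] at h0
        exact eq_neg_of_add_eq_zero_right h0
      rw [neg_smul, mul_smul, ← smul_neg, ← this, smul_smul, inv_mul_cancel₀ hs, one_smul]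
  · refine ⟨-(t⁻¹ * r), -(t⁻¹ * s), ?_⟩
    ext i
    have := congrFun h0 i
    simp only [Pi.add_apply, Pi.smul_apply, smul_eq_mul, Pi.zero_apply] at this ⊢
    field_simp
    linear_combination this

end Lines

section Intersection

variable {f : MvPolynomial (Fin 3) F} {d : ℕ} {a : Fin 3 → F}
  {v w : Fin 3 → AlgebraicClosure F}

lemma eq_of_rep_eq_smul {K : Type*} [Field K] {P Q : ProjPlane K} {x : Fin 3 → K} {r s : K}
    (hP : P.rep = r • x) (hQ : Q.rep = s • x) : P = Q := by
  have hs : s ≠ 0 := by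
    rintro rfl
    exact Q.rep_nonzero (by simpa using hQ)
  rw [← P.mk_rep, ← Q.mk_rep, Projectivization.mk_eq_mk_iff']
  refine ⟨r * s⁻¹, ?_⟩
  rw [hP, hQ, smul_smul, mul_assoc, inv_mul_cancel₀ hs, mul_one]

lemma onCurve_mk_iff (hf : f.IsHomogeneous d) (hv : v ≠ 0) :
    OnCurve f (Projectivization.mk _ v hv) ↔ aeval v f = 0 := by
  obtain ⟨c, hc⟩ := Projectivization.exists_smul_eq_mk_rep (AlgebraicClosure F) v hv
  rw [OnCurve, ← hc, Units.smul_def, aeval_smul_of_isHomogeneous hf]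
  simp

lemma onLine_mk_iff (hv : v ≠ 0) :
    OnLine a (Projectivization.mk _ v hv) ↔
      ∑ i, algebraMap F (AlgebraicClosure F) (a i) * v i = 0 := by
  obtain ⟨c, hc⟩ := Projectivization.exists_smul_eq_mk_rep (AlgebraicClosure F) v hv
  have h : ∀ i, algebraMap F (AlgebraicClosure F) (a i) * (c • v) i =
      (c : AlgebraicClosure F) * (algebraMap F (AlgebraicClosure F) (a i) * v i) := fun i => by
    simp only [Pi.smul_apply, Units.smul_def, smul_eq_mul]
    ring
  rw [OnLine, ← hc]
  simp only [h, ← Finset.mul_sum]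
  simp

lemma algebraMap_comp_ne_zero {K : Type*} [Field K] [Algebra F K] {a : Fin 3 → F} (ha : a ≠ 0) :
    (fun i => algebraMap F K (a i)) ≠ 0 := fun h =>
  ha (funext fun i => by simpa using congrFun h i)

lemma ne_smul_of_aeval_ne_zero (hf : f.IsHomogeneous d) (hvf : aeval v f = 0)
    (hwf : aeval w f ≠ 0) (c : AlgebraicClosure F) : w ≠ c • v := by
  rintro rfl
  exact hwf (by rw [aeval_smul_of_isHomogeneous hf, hvf, mul_zero])

open scoped Classical in
/-- The points of a line on a curve are among those given by the roots of the restriction of the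
equation of the curve to the line. -/
lemma finite_and_ncard_le_card_roots (hf : f.IsHomogeneous d) (ha : a ≠ 0) (hv0 : v ≠ 0)
    (hv : ∑ i, algebraMap F (AlgebraicClosure F) (a i) * v i = 0)
    (hw : ∑ i, algebraMap F (AlgebraicClosure F) (a i) * w i = 0)
    (hvf : aeval v f = 0) (hwf : aeval w f ≠ 0) :
    {P : ProjPlane (AlgebraicClosure F) | OnCurve f P ∧ OnLine a P}.Finite ∧
      {P : ProjPlane (AlgebraicClosure F) | OnCurve f P ∧ OnLine a P}.ncard ≤
        (LinePoly f v w).roots.toFinset.card := by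
  have key : ∀ P : ProjPlane (AlgebraicClosure F), OnCurve f P ∧ OnLine a P →
      ∃ t : AlgebraicClosure F, t ∈ (LinePoly f v w).roots.toFinset ∧
        ∃ r : AlgebraicClosure F, P.rep = r • (v + t • w) := by
    rintro P ⟨hPf, hPa⟩
    obtain ⟨r, s, h⟩ := exists_eq_smul_add_smul (algebraMap_comp_ne_zero ha) hv hw hPa hv0
      (ne_smul_of_aeval_ne_zero hf hvf hwf)
    have hr : r ≠ 0 := by
      rintro rfl
      have hs : s ≠ 0 := by
        rintro rfl
        exact P.rep_nonzero (by simpa using h)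
      rw [OnCurve, h, zero_smul, zero_add, aeval_smul_of_isHomogeneous hf] at hPf
      exact (mul_ne_zero (pow_ne_zero _ hs) hwf) hPf
    have h' : P.rep = r • (v + (r⁻¹ * s) • w) := by
      rw [h, smul_add, smul_smul, mul_inv_cancel_left₀ hr]
    refine ⟨r⁻¹ * s, ?_, r, h'⟩
    rw [Multiset.mem_toFinset, Polynomial.mem_roots (linePoly_ne_zero hf hwf), Polynomial.IsRoot,
      eval_linePoly]
    rw [OnCurve, h', aeval_smul_of_isHomogeneous hf] at hPf
    exact (mul_eq_zero.mp hPf).resolve_left (pow_ne_zero _ hr)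
  choose! τ hτ hrep using key
  have hmaps : Set.MapsTo τ {P : ProjPlane (AlgebraicClosure F) | OnCurve f P ∧ OnLine a P}
      ((LinePoly f v w).roots.toFinset : Set (AlgebraicClosure F)) := fun P hP => hτ P hP
  have hinj : Set.InjOn τ {P : ProjPlane (AlgebraicClosure F) | OnCurve f P ∧ OnLine a P} := by
    intro P hP Q hQ h
    obtain ⟨r, hr⟩ := hrep P hP
    obtain ⟨s, hs⟩ := hrep Q hQ
    exact eq_of_rep_eq_smul hr (h ▸ hs)
  refine ⟨Set.Finite.of_injOn hmaps hinj (Finset.finite_toSet _), ?_⟩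
  rw [← Set.ncard_coe_finset]
  exact Set.ncard_le_ncard_of_injOn τ hmaps hinj (Finset.finite_toSet _)

open scoped Classical in
lemma card_roots_linePoly_le (hf : f.IsHomogeneous d) (v w : Fin 3 → AlgebraicClosure F) :
    (LinePoly f v w).roots.toFinset.card ≤ d :=
  (Multiset.toFinset_card_le _).trans
    ((Polynomial.card_roots' _).trans (natDegree_linePoly_le hf v w))

open scoped Classical in
lemma card_roots_linePoly_lt_of_tangent (hf : f.IsHomogeneous d) (hvf : aeval v f = 0)
    (hwf : aeval w f ≠ 0) (htan : ∑ i, aeval v (pderiv i f) * w i = 0) :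
    (LinePoly f v w).roots.toFinset.card < d := by
  have h0 := linePoly_ne_zero (v := v) hf hwf
  have hmult : 1 < (LinePoly f v w).rootMultiplicity 0 := by
    rw [Polynomial.one_lt_rootMultiplicity_iff_isRoot h0]
    refine ⟨?_, ?_⟩
    · simpa [Polynomial.IsRoot, eval_linePoly] using hvf
    · simpa [Polynomial.IsRoot, eval_zero_derivative_linePoly] using htan
  refine lt_of_lt_of_le ?_ ((Polynomial.card_roots' _).trans (natDegree_linePoly_le hf v w))
  refine lt_of_le_of_ne (Multiset.toFinset_card_le _) fun h => ?_
  have hnodup := Multiset.toFinset_card_eq_card_iff_nodup.mp h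
  have := Multiset.nodup_iff_count_le_one.mp hnodup 0
  rw [Polynomial.count_roots] at this
  omega

/-- A line contained in a curve meets it in infinitely many points. -/
lemma infinite_of_forall_aeval_eq_zero (hf : f.IsHomogeneous d) (hv0 : v ≠ 0)
    (hvw : ∀ c : AlgebraicClosure F, w ≠ c • v)
    (hv : ∑ i, algebraMap F (AlgebraicClosure F) (a i) * v i = 0)
    (hw : ∑ i, algebraMap F (AlgebraicClosure F) (a i) * w i = 0)
    (h : ∀ t : AlgebraicClosure F, aeval (v + t • w) f = 0) :
    {P : ProjPlane (AlgebraicClosure F) | OnCurve f P ∧ OnLine a P}.Infinite := by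
  have indep : ∀ r s : AlgebraicClosure F, r • v + s • w = 0 → r = 0 ∧ s = 0 := by
    intro r s hrs
    have hs : s = 0 := by
      by_contra hs
      refine hvw (-(s⁻¹ * r)) ?_
      rw [neg_smul, mul_smul, ← smul_neg, ← eq_neg_of_add_eq_zero_right hrs, smul_smul,
        inv_mul_cancel₀ hs, one_smul]
    subst hs
    simpa [hv0] using hrs
  have hne : ∀ t : AlgebraicClosure F, v + t • w ≠ 0 := fun t ht =>
    one_ne_zero (indep 1 t (by simpa using ht)).1
  refine Set.infinite_of_injective_forall_mem
    (f := fun t : AlgebraicClosure F => Projectivization.mk _ (v + t • w) (hne t)) ?_ fun t => ?_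
  · intro s t hst
    obtain ⟨c, hc⟩ := (Projectivization.mk_eq_mk_iff' _ _ _ _ _).mp hst
    have h2 := indep (c - 1) (c * t - s) (by
      rw [sub_smul, sub_smul, mul_smul, one_smul]
      rw [smul_add] at hc
      linear_combination hc)
    have hc1 : c = 1 := sub_eq_zero.mp h2.1
    have := sub_eq_zero.mp h2.2
    rw [hc1, one_mul] at this
    exact this.symm
  · refine ⟨(onCurve_mk_iff hf _).mpr (h t), (onLine_mk_iff _).mpr ?_⟩
    simp only [Pi.add_apply, Pi.smul_apply, smul_eq_mul, mul_add, Finset.sum_add_distrib, hv,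
      mul_left_comm _ t, ← Finset.mul_sum, hw]
    simp

/-- A transverse line through a point of the curve contains no further point of the tangent line
at that point. -/
lemma Transverse.exists_eq_smul_rep (hf : f.IsHomogeneous d) (hd : d ≠ 0) (ha : a ≠ 0)
    (htr : Transverse f a d) {P : ProjPlane (AlgebraicClosure F)} (hPf : OnCurve f P)
    (hPa : OnLine a P) (hw : ∑ i, algebraMap F (AlgebraicClosure F) (a i) * w i = 0)
    (htan : ∑ i, aeval P.rep (pderiv i f) * w i = 0) :
    ∃ c : AlgebraicClosure F, w = c • P.rep := by
  by_contra! hne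
  have hfin : {P : ProjPlane (AlgebraicClosure F) | OnCurve f P ∧ OnLine a P}.Finite :=
    Set.finite_of_ncard_ne_zero (by rwa [htr])
  obtain ⟨t, ht⟩ : ∃ t : AlgebraicClosure F, aeval (P.rep + t • w) f ≠ 0 := by
    by_contra! h
    exact infinite_of_forall_aeval_eq_zero hf P.rep_nonzero hne hPa hw h hfin
  have hlin : ∀ y : Fin 3 → AlgebraicClosure F, ∑ i, y i * P.rep i = 0 → ∑ i, y i * w i = 0 →
      ∑ i, y i * (P.rep + t • w) i = 0 := fun y h1 h2 => by
    simp only [Pi.add_apply, Pi.smul_apply, smul_eq_mul, mul_add, Finset.sum_add_distrib, h1,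
      mul_left_comm _ t, ← Finset.mul_sum, h2]
    simp
  have h1 := (finite_and_ncard_le_card_roots hf ha P.rep_nonzero hPa (hlin _ hPa hw) hPf ht).2
  have h2 := card_roots_linePoly_lt_of_tangent hf hPf ht
    (hlin _ (sum_aeval_pderiv_mul_self hf hPf) htan)
  exact absurd htr (h1.trans_lt h2).ne

end Intersection

section RationalPoints

lemma mem_range_algebraMap_of_pow_card_eq [Fintype F] {K : Type*} [Field K] [Algebra F K] {x : K}
    (hx : x ^ Fintype.card F = x) : ∃ y : F, algebraMap F K y = x := by
  classical
  have hne : (Polynomial.X ^ Fintype.card F - Polynomial.X : Polynomial K) ≠ 0 :=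
    FiniteField.X_pow_card_sub_X_ne_zero K Fintype.one_lt_card
  have hmem : ∀ z : K, z ∈ (Polynomial.X ^ Fintype.card F - Polynomial.X :
      Polynomial K).roots.toFinset ↔ z ^ Fintype.card F = z := fun z => by
    simp [Polynomial.mem_roots hne, Polynomial.IsRoot, sub_eq_zero]
  have heq : Finset.univ.image (algebraMap F K) =
      (Polynomial.X ^ Fintype.card F - Polynomial.X : Polynomial K).roots.toFinset := by
    refine Finset.eq_of_subset_of_card_le ?_ ?_
    · intro z hz
      obtain ⟨y, -, rfl⟩ := Finset.mem_image.mp hz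
      rw [hmem, ← map_pow, FiniteField.pow_card]
    · rw [Finset.card_image_of_injective _ (algebraMap F K).injective, Finset.card_univ]
      refine (Multiset.toFinset_card_le _).trans ((Polynomial.card_roots' _).trans ?_)
      rw [FiniteField.X_pow_card_sub_X_natDegree_eq K Fintype.one_lt_card]
  have := heq ▸ (hmem x).mpr hx
  simpa using this

/-- A geometric point fixed by the Frobenius map is rational. -/
lemma isRationalPt_of_pow_card_eq_smul [Fintype F] {P : ProjPlane (AlgebraicClosure F)}
    {c : AlgebraicClosure F} (h : (fun i => P.rep i ^ Fintype.card F) = c • P.rep) :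
    IsRationalPt P := by
  obtain ⟨j, hj⟩ : ∃ j, P.rep j ≠ 0 := Function.ne_iff.mp P.rep_nonzero
  have hi : ∀ i, P.rep i ^ Fintype.card F = c * P.rep i := fun i => congrFun h i
  have hc : c ≠ 0 := by
    rintro rfl
    exact pow_ne_zero _ hj ((hi j).trans (zero_mul _))
  have hrat : ∀ i, ∃ y : F, algebraMap F (AlgebraicClosure F) y = P.rep i / P.rep j := fun i => by
    refine mem_range_algebraMap_of_pow_card_eq ?_
    rw [div_pow, hi, hi, mul_div_mul_left _ _ hc]
  choose y hy using hrat
  refine ⟨y, fun h0 => ?_, P.rep j, hj, fun i => ?_⟩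
  · have := hy j
    simp [h0, div_self hj] at this
  · rw [hy, mul_div_cancel₀ _ hj]

/-- The geometric point underlying a rational point. -/
def geometricPoint (P : ProjPlane F) : ProjPlane (AlgebraicClosure F) :=
  Projectivization.mk _ (fun i => algebraMap F (AlgebraicClosure F) (P.rep i))
    (algebraMap_comp_ne_zero P.rep_nonzero)

lemma geometricPoint_injective : Function.Injective (geometricPoint (F := F)) := by
  intro P Q h
  obtain ⟨c, hc⟩ := (Projectivization.mk_eq_mk_iff' _ _ _ _ _).mp h
  have hi : ∀ i, c * algebraMap F (AlgebraicClosure F) (Q.rep i) =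
    algebraMap F (AlgebraicClosure F) (P.rep i) := fun i => congrFun hc i
  obtain ⟨j, hj⟩ : ∃ j, Q.rep j ≠ 0 := Function.ne_iff.mp Q.rep_nonzero
  have hj' : algebraMap F (AlgebraicClosure F) (Q.rep j) ≠ 0 := by simpa using hj
  refine eq_of_rep_eq_smul (x := Q.rep) (r := P.rep j / Q.rep j) (s := 1) ?_ (one_smul _ _).symm
  ext i
  apply (algebraMap F (AlgebraicClosure F)).injective
  simp only [Pi.smul_apply, smul_eq_mul, map_mul, map_div₀, ← hi]
  field_simp

lemma onCurve_geometricPoint {f : MvPolynomial (Fin 3) F} {d : ℕ} (hf : f.IsHomogeneous d)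
    (P : ProjPlane F) : OnCurve f (geometricPoint P) ↔ eval P.rep f = 0 := by
  rw [geometricPoint, onCurve_mk_iff hf]
  have : aeval (fun i => algebraMap F (AlgebraicClosure F) (P.rep i)) f =
      algebraMap F (AlgebraicClosure F) (eval P.rep f) :=
    aeval_algebraMap_apply (AlgebraicClosure F) P.rep f
  rw [this]
  simp

lemma onLine_geometricPoint (a : Fin 3 → F) (P : ProjPlane F) :
    OnLine a (geometricPoint P) ↔ ∑ i, a i * P.rep i = 0 := by
  rw [geometricPoint, onLine_mk_iff]
  simp only [← map_mul, ← map_sum, map_eq_zero]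

lemma IsRationalPt.exists_geometricPoint_eq {P : ProjPlane (AlgebraicClosure F)}
    (hP : IsRationalPt P) : ∃ Q : ProjPlane F, geometricPoint Q = P := by
  obtain ⟨v, hv, c, hc, h⟩ := hP
  refine ⟨Projectivization.mk F v hv, ?_⟩
  obtain ⟨b, hb⟩ := Projectivization.exists_smul_eq_mk_rep F v hv
  rw [← P.mk_rep, geometricPoint, Projectivization.mk_eq_mk_iff']
  refine ⟨algebraMap F _ (b : F) * c⁻¹, ?_⟩
  ext i
  rw [← hb]
  simp only [Pi.smul_apply, smul_eq_mul, h, Units.smul_def, map_mul]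
  field_simp

end RationalPoints

section ContainedLines

variable {f : MvPolynomial (Fin 3) F} {d : ℕ} {a : Fin 3 → F}
  {u v : Fin 3 → AlgebraicClosure F}

/-- A form of positive degree has a zero on every line. -/
lemma exists_zero_on_line (hf : f.IsHomogeneous d) (hd : d ≠ 0) (hv0 : v ≠ 0)
    (huv : ∀ c : AlgebraicClosure F, u ≠ c • v) :
    ∃ r s : AlgebraicClosure F, r • u + s • v ≠ 0 ∧ aeval (r • u + s • v) f = 0 := by
  by_cases hvf : aeval v f = 0
  · exact ⟨0, 1, by simpa using hv0, by simpa using hvf⟩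
  by_cases hdeg : (LinePoly f u v).degree = 0
  · exfalso
    obtain ⟨c, hc⟩ : ∃ c, LinePoly f u v = Polynomial.C c :=
      ⟨_, Polynomial.eq_C_of_degree_eq_zero hdeg⟩
    have hk : (LinePoly f v u - Polynomial.C c * Polynomial.X ^ d) * Polynomial.X = 0 := by
      refine Polynomial.funext fun s => ?_
      rcases eq_or_ne s 0 with rfl | hs
      · simp
      · have h : v + s • u = s • (u + s⁻¹ • v) := by
          rw [smul_add, smul_smul, mul_inv_cancel₀ hs, one_smul, add_comm]
        rw [Polynomial.eval_mul, Polynomial.eval_sub, eval_linePoly, h,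
          aeval_smul_of_isHomogeneous hf, ← eval_linePoly, hc]
        rw [Polynomial.eval_C, Polynomial.eval_mul, Polynomial.eval_C, Polynomial.eval_pow,
          Polynomial.eval_X, mul_comm c, sub_self, zero_mul, Polynomial.eval_zero]
    have := congrArg (Polynomial.eval 0)
      ((mul_eq_zero.mp hk).resolve_right Polynomial.X_ne_zero)
    exact hvf (by simpa [eval_linePoly, hd] using this)
  · obtain ⟨t, ht⟩ := IsAlgClosed.exists_root _ hdeg
    refine ⟨1, t, fun h => huv (-t) ?_, ?_⟩
    · rw [one_smul] at h
      rw [neg_smul]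
      exact eq_neg_of_add_eq_zero_left h
    · rwa [Polynomial.IsRoot, eval_linePoly, ← one_smul (AlgebraicClosure F) u] at ht

/-- A smooth plane curve of degree at least two contains no line. -/
lemma SmoothCurve.exists_aeval_ne_zero (hsm : SmoothCurve f) (hf : f.IsHomogeneous d)
    (hd : 2 ≤ d) (ha : a ≠ 0) (hv0 : v ≠ 0) (huv : ∀ c : AlgebraicClosure F, u ≠ c • v)
    (hu : ∑ i, algebraMap F (AlgebraicClosure F) (a i) * u i = 0)
    (hv : ∑ i, algebraMap F (AlgebraicClosure F) (a i) * v i = 0) :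
    ∃ w : Fin 3 → AlgebraicClosure F,
      ∑ i, algebraMap F (AlgebraicClosure F) (a i) * w i = 0 ∧ aeval w f ≠ 0 := by
  by_contra! hall
  obtain ⟨j, hj⟩ : ∃ j, a j ≠ 0 := Function.ne_iff.mp ha
  obtain ⟨r, s, hx0, hx⟩ := exists_zero_on_line (hf.pderiv (i := j)) (by omega) hv0 huv
  have hcomb : ∀ {x y : Fin 3 → AlgebraicClosure F} (r s : AlgebraicClosure F),
      ∑ i, algebraMap F (AlgebraicClosure F) (a i) * x i = 0 →
      ∑ i, algebraMap F (AlgebraicClosure F) (a i) * y i = 0 →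
      ∑ i, algebraMap F (AlgebraicClosure F) (a i) * (r • x + s • y) i = 0 := by
    intro x y r s hx hy
    simp only [Pi.add_apply, Pi.smul_apply, smul_eq_mul, mul_add, Finset.sum_add_distrib,
      mul_left_comm _ r, mul_left_comm _ s, ← Finset.mul_sum, hx, hy]
    simp
  have hxa := hcomb r s hu hv
  set x := r • u + s • v
  have htan : ∀ w : Fin 3 → AlgebraicClosure F,
      ∑ i, algebraMap F (AlgebraicClosure F) (a i) * w i = 0 →
      ∑ i, aeval x (pderiv i f) * w i = 0 := by
    intro w hw
    have h0 : LinePoly f x w = 0 := Polynomial.funext fun t => by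
      rw [eval_linePoly, Polynomial.eval_zero]
      exact hall _ (by simpa only [one_smul] using hcomb 1 t hxa hw)
    rw [← eval_zero_derivative_linePoly, h0]
    simp
  obtain ⟨i, hi⟩ := hsm (Projectivization.mk _ x hx0) ((onCurve_mk_iff hf hx0).mpr (hall x hxa))
  refine hi ((onCurve_mk_iff hf.pderiv hx0).mpr ?_)
  have h := htan (Pi.single i (algebraMap F _ (a j)) - Pi.single j (algebraMap F _ (a i))) (by
    simp [mul_sub, Finset.sum_sub_distrib, Pi.single_apply, mul_comm])
  simpa [mul_sub, Finset.sum_sub_distrib, Pi.single_apply, hx, hj] using h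

/-- A nonzero linear form is nonzero at one of the standard basis vectors. -/
lemma exists_eval_single_ne_zero (hf0 : f ≠ 0) (hf : f.IsHomogeneous 1) :
    ∃ i, eval (Pi.single i 1) f ≠ 0 := by
  by_contra! h
  have hconst : ∀ i, ∃ c, pderiv i f = C c := fun i =>
    ⟨_, totalDegree_eq_zero_iff_eq_C.mp (Nat.le_zero.mp hf.pderiv.totalDegree_le)⟩
  choose c hc using hconst
  have heuler : ∑ i, X i * C (c i) = f := by simpa [hc] using hf.sum_X_mul_pderiv
  have hc0 : ∀ i, c i = 0 := fun i => by
    have := h i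
    rw [← heuler] at this
    simpa [Pi.single_apply] using this
  exact hf0 (by rw [← heuler]; simp [hc0])

/-- A line with `d` rational points on a curve of degree `d` that it is not contained in is
transverse to the curve. -/
lemma transverse_of_card_eq (hf : f.IsHomogeneous d) (hd : d ≠ 0) (ha : a ≠ 0)
    {S : Finset (ProjPlane F)} (hcard : S.card = d)
    (hS : ∀ P ∈ S, eval P.rep f = 0 ∧ ∑ i, a i * P.rep i = 0)
    {w : Fin 3 → AlgebraicClosure F}
    (hw : ∑ i, algebraMap F (AlgebraicClosure F) (a i) * w i = 0) (hwf : aeval w f ≠ 0) :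
    Transverse f a d := by
  classical
  have hmem : ∀ P ∈ S, OnCurve f (geometricPoint P) ∧ OnLine a (geometricPoint P) := fun P hP =>
    ⟨(onCurve_geometricPoint hf P).mpr (hS P hP).1, (onLine_geometricPoint a P).mpr (hS P hP).2⟩
  obtain ⟨P, hP⟩ : S.Nonempty := Finset.card_pos.mp (by omega)
  obtain ⟨hfin, hle⟩ := finite_and_ncard_le_card_roots hf ha (geometricPoint P).rep_nonzero
    (hmem P hP).2 hw (hmem P hP).1 hwf
  refine le_antisymm (hle.trans (card_roots_linePoly_le hf _ _)) ?_
  calc d = (S.image geometricPoint).card := by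
        rw [Finset.card_image_of_injective _ geometricPoint_injective, hcard]
    _ = ((S.image geometricPoint : Finset _) : Set (ProjPlane (AlgebraicClosure F))).ncard :=
        (Set.ncard_coe_finset _).symm
    _ ≤ _ := Set.ncard_le_ncard (fun Q hQ => by
        obtain ⟨P, hP, rfl⟩ := Finset.mem_image.mp hQ
        exact hmem P hP) hfin

end ContainedLines

/-- For a smooth Frobenius non-classical plane curve of degree `d` over `F_q`, there is an
`F_q`-line meeting `C` transversely if and only if there is an `F_q`-line containing `d`
distinct `F_q`-rational points of `C`. -/
theorem frobenius_nonclassical_transverse_iff_collinear_points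
    (p q d : ℕ) [Fact p.Prime] (hp : 2 < p)
    (F : Type*) [Field F] [Fintype F] [CharP F p] (hcard : Fintype.card F = q)
    (f : MvPolynomial (Fin 3) F) (hf0 : f ≠ 0) (hfd : f.IsHomogeneous d)
    (hsmooth : SmoothCurve f)
    (hfnc : FrobeniusNonClassical f q) :
    (∃ a : Fin 3 → F, a ≠ 0 ∧ Transverse f a d) ↔
      (∃ a : Fin 3 → F, a ≠ 0 ∧ ∃ S : Finset (Projectivization F (Fin 3 → F)),
        S.card = d ∧ ∀ P ∈ S, eval P.rep f = 0 ∧ ∑ i, a i * P.rep i = 0) := by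
  constructor
  · rintro ⟨a, ha, htr⟩
    refine ⟨a, ha, ?_⟩
    rcases eq_or_ne d 0 with rfl | hd
    · exact ⟨∅, rfl, by simp⟩
    have hrat : {P : ProjPlane (AlgebraicClosure F) | OnCurve f P ∧ OnLine a P} ⊆
        Set.range geometricPoint := by
      rintro P ⟨hPf, hPa⟩
      have hline : ∑ i, algebraMap F (AlgebraicClosure F) (a i) * P.rep i ^ q = 0 := by
        have h := congrArg (FiniteField.frobeniusAlgHom F (AlgebraicClosure F)) hPa
        simp only [map_zero, map_sum, map_mul, AlgHom.commutes] at h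
        simpa [hcard] using h
      obtain ⟨c, hc⟩ := htr.exists_eq_smul_rep hfd hd ha hPf hPa hline (hfnc P hPf)
      exact (isRationalPt_of_pow_card_eq_smul (hcard ▸ hc)).exists_geometricPoint_eq
    have hfin : {P : ProjPlane (AlgebraicClosure F) | OnCurve f P ∧ OnLine a P}.Finite :=
      Set.finite_of_ncard_ne_zero (by rwa [htr])
    have hpre := hfin.preimage (geometricPoint_injective (F := F)).injOn
    refine ⟨hpre.toFinset, ?_, fun P hP => ?_⟩
    · rw [← Set.ncard_eq_toFinset_card _ hpre,
        Set.ncard_preimage_of_injective_subset_range geometricPoint_injective hrat]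
      exact htr
    · obtain ⟨h1, h2⟩ := hpre.mem_toFinset.mp hP
      exact ⟨(onCurve_geometricPoint hfd P).mp h1, (onLine_geometricPoint a P).mp h2⟩
  · rintro ⟨a, ha, S, hScard, hS⟩
    rcases (by omega : d = 0 ∨ d = 1 ∨ 2 ≤ d) with rfl | rfl | hd
    · refine ⟨a, ha, ?_⟩
      obtain ⟨c, rfl⟩ : ∃ c, f = C c :=
        ⟨_, totalDegree_eq_zero_iff_eq_C.mp (Nat.le_zero.mp hfd.totalDegree_le)⟩
      have hc : c ≠ 0 := by simpa using hf0
      simp [Transverse, OnCurve, hc]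
    · obtain ⟨j, hj⟩ := exists_eval_single_ne_zero hf0 hfd
      obtain ⟨P, rfl⟩ := Finset.card_eq_one.mp hScard
      have hdet : (Matrix.of ![P.rep, Pi.single j 1, 0]).det = 0 :=
        Matrix.det_eq_zero_of_row_eq_zero 2 fun i => by simp
      obtain ⟨b, hb, hmul⟩ := Matrix.exists_mulVec_eq_zero_iff.mpr hdet
      have hbP : ∑ i, b i * P.rep i = 0 := by
        simpa [Matrix.mulVec, dotProduct, mul_comm] using congrFun hmul 0
      have hbj : b j = 0 := by
        simpa [Matrix.mulVec, dotProduct, Pi.single_apply] using congrFun hmul 1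
      refine ⟨b, hb, transverse_of_card_eq hfd one_ne_zero hb hScard
        (fun Q hQ => ⟨(hS Q hQ).1, ?_⟩)
        (w := fun i => algebraMap F _ ((Pi.single j 1 : Fin 3 → F) i)) ?_ ?_⟩
      · rwa [Finset.mem_singleton.mp hQ]
      · simp [Pi.single_apply, hbj]
      · have h : aeval (fun i => algebraMap F (AlgebraicClosure F)
            ((Pi.single j 1 : Fin 3 → F) i)) f =
            algebraMap F (AlgebraicClosure F) (eval (Pi.single j 1) f) :=
          aeval_algebraMap_apply (AlgebraicClosure F) _ f
        rw [h]
        simpa using hj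
    · obtain ⟨P, hP, Q, hQ, hPQ⟩ := Finset.one_lt_card.mp (by omega : 1 < S.card)
      obtain ⟨w, hw, hwf⟩ := hsmooth.exists_aeval_ne_zero hfd hd ha (geometricPoint Q).rep_nonzero
        (fun c hc => hPQ (geometricPoint_injective (eq_of_rep_eq_smul hc (one_smul _ _).symm)))
        ((onLine_geometricPoint a P).mpr (hS P hP).2) ((onLine_geometricPoint a Q).mpr (hS Q hQ).2)
      exact ⟨a, ha, transverse_of_card_eq hfd (by omega) ha hScard hS hw hwf⟩

end
end
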